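/- arXiv:2508.05573 — 2 statements merged into one kernel-verified Lean document; each statement's English description precedes it below -/
import Mathlib

section
/- For all real numbers 0 < α < β there exists a constant C = C(α, β) such that the following holds. Let G : ℝ → ℝ be twice continuously differentiable on [0,1] with α ≤ G''(t) ≤ β for all t ∈ [0,1], let X and Y be real numbers with 1 ≤ X ≤ Y², and let δ > 0. Then the number of pairs of integers (x, y) with 0 ≤ x ≤ X and |y − Y·G(x/X)| ≤ δ is at most C (δX + (XY)^{1/3}). -/
/-- The additive character `t ↦ exp (2πit)`. -/
noncomputable def expTwoPiI (t : ℝ) : ℂ := Complex.exp ((2 * Real.pi * t : ℝ) * Complex.I)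

namespace expTwoPiI

lemma norm (t : ℝ) : ‖expTwoPiI t‖ = 1 := Complex.norm_exp_ofReal_mul_I _

lemma add (s t : ℝ) : expTwoPiI (s + t) = expTwoPiI s * expTwoPiI t := by
  unfold expTwoPiI
  rw [← Complex.exp_add]
  push_cast
  ring_nf

lemma re (t : ℝ) : (expTwoPiI t).re = Real.cos (2 * Real.pi * t) :=
  Complex.exp_ofReal_mul_I_re _

lemma im (t : ℝ) : (expTwoPiI t).im = Real.sin (2 * Real.pi * t) :=
  Complex.exp_ofReal_mul_I_im _

lemma star_eq (t : ℝ) : (starRingEnd ℂ) (expTwoPiI t) = expTwoPiI (-t) := by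
  apply Complex.ext
  · simp [re]
  · simp [im]

lemma int (k : ℤ) : expTwoPiI k = 1 := by
  unfold expTwoPiI
  rw [Complex.exp_eq_one_iff]
  exact ⟨k, by push_cast; ring⟩

lemma sub_int (t : ℝ) (k : ℤ) : expTwoPiI (t - k) = expTwoPiI t := by
  have h := add (t - k) k
  rw [int, mul_one, sub_add_cancel] at h
  exact h.symm

end expTwoPiI

/-- `(1 - expTwoPiI t)⁻¹`, written through the cotangent. -/
noncomputable def cotWeight (t : ℝ) : ℂ :=
  ⟨1 / 2, Real.cos (Real.pi * t) / Real.sin (Real.pi * t) / 2⟩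

lemma cotWeight_mul_one_sub {t : ℝ} (ht : Real.sin (Real.pi * t) ≠ 0) :
    cotWeight t * (1 - expTwoPiI t) = 1 := by
  have h2 : 2 * Real.pi * t = 2 * (Real.pi * t) := by ring
  have hsq := Real.sin_sq_add_cos_sq (Real.pi * t)
  apply Complex.ext
  · simp only [cotWeight, Complex.mul_re, Complex.sub_re, Complex.sub_im, Complex.one_re,
      Complex.one_im, expTwoPiI.re, expTwoPiI.im, h2, Real.cos_two_mul, Real.sin_two_mul]
    field_simp
    ring
  · simp only [cotWeight, Complex.mul_im, Complex.sub_re, Complex.sub_im, Complex.one_re,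
      Complex.one_im, expTwoPiI.re, expTwoPiI.im, h2, Real.cos_two_mul, Real.sin_two_mul]
    field_simp
    linear_combination (-2) * Real.cos (Real.pi * t) * hsq

lemma two_mul_le_sin_pi_mul {θ t : ℝ} (hθ : 0 ≤ θ) (h₁ : θ ≤ t) (h₂ : t ≤ 1 - θ) :
    2 * θ ≤ Real.sin (Real.pi * t) := by
  have hpi := Real.pi_pos
  rcases le_total t (1 / 2) with h | h
  · have := Real.mul_le_sin (x := Real.pi * t) (by nlinarith) (by nlinarith)
    have e : 2 / Real.pi * (Real.pi * t) = 2 * t := by field_simp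
    linarith
  · have := Real.mul_le_sin (x := Real.pi - Real.pi * t) (by nlinarith) (by nlinarith)
    rw [Real.sin_pi_sub] at this
    have e : 2 / Real.pi * (Real.pi - Real.pi * t) = 2 * (1 - t) := by field_simp
    linarith

lemma norm_cotWeight_le {θ t : ℝ} (hθ : 0 < θ) (h₁ : θ ≤ t) (h₂ : t ≤ 1 - θ) :
    |(cotWeight t).im| ≤ 1 / (4 * θ) ∧ ‖cotWeight t‖ ≤ 1 / 2 + 1 / (4 * θ) := by
  have hs := two_mul_le_sin_pi_mul hθ.le h₁ h₂
  have him : |(cotWeight t).im| ≤ 1 / (4 * θ) := by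
    simp only [cotWeight, abs_div, abs_two]
    rw [abs_of_pos (a := Real.sin _) (by linarith), div_div]
    exact div_le_div₀ zero_le_one (Real.abs_cos_le_one _) (by positivity) (by linarith)
  refine ⟨him, (Complex.norm_le_abs_re_add_abs_im _).trans ?_⟩
  have : |(cotWeight t).re| = 1 / 2 := by simp [cotWeight]
  linarith

lemma norm_cotWeight_sub {s t : ℝ} (hs : 0 < s) (hst : s ≤ t) (ht : t < 1) :
    ‖cotWeight t - cotWeight s‖ = (cotWeight s).im - (cotWeight t).im := by
  have hpi := Real.pi_pos
  have h1 : 0 < Real.sin (Real.pi * s) :=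
    Real.sin_pos_of_pos_of_lt_pi (by positivity) (by nlinarith)
  have h2 : 0 < Real.sin (Real.pi * t) :=
    Real.sin_pos_of_pos_of_lt_pi (by nlinarith) (by nlinarith)
  have h3 : 0 ≤ Real.sin (Real.pi * t - Real.pi * s) :=
    Real.sin_nonneg_of_nonneg_of_le_pi (by nlinarith) (by nlinarith)
  rw [Real.sin_sub] at h3
  have h4 : (cotWeight t).im ≤ (cotWeight s).im := by
    simp only [cotWeight]
    have : Real.cos (Real.pi * t) / Real.sin (Real.pi * t)
        ≤ Real.cos (Real.pi * s) / Real.sin (Real.pi * s) := by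
      rw [div_le_div_iff₀ h2 h1]
      linarith
    linarith
  have h5 : cotWeight t - cotWeight s
      = (((cotWeight t).im - (cotWeight s).im : ℝ) : ℂ) * Complex.I := by
    apply Complex.ext
    · simp only [Complex.sub_re, Complex.re_ofReal_mul, Complex.I_re]
      simp [cotWeight]
    · simp only [Complex.sub_im, Complex.im_ofReal_mul, Complex.I_im, mul_one]
  rw [h5, norm_mul, Complex.norm_I, mul_one, Complex.norm_real, Real.norm_eq_abs, abs_sub_comm,
    abs_of_nonneg (by linarith)]

/-- The Kusmin–Landau inequality, for sequences whose differences lie in `[θ, 1 - θ]`. -/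
lemma norm_sum_expTwoPiI_le_of_sub_mem (x : ℕ → ℝ) {θ : ℝ} (hθ : 0 < θ) {a b : ℕ} (hab : a ≤ b)
    (hmono : ∀ n, x (n + 1) - x n ≤ x (n + 2) - x (n + 1))
    (hmem : ∀ n, a ≤ n → n ≤ b → θ ≤ x (n + 1) - x n ∧ x (n + 1) - x n ≤ 1 - θ) :
    ‖∑ n ∈ Finset.Icc a b, expTwoPiI (x n)‖ ≤ 2 / θ := by
  set c : ℕ → ℂ := fun n => cotWeight (x (n + 1) - x n) with hc
  have hz : ∀ n, a ≤ n → n ≤ b →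
      expTwoPiI (x n) + c n * expTwoPiI (x (n + 1)) = c n * expTwoPiI (x n) := by
    intro n h1 h2
    obtain ⟨h3, h4⟩ := hmem n h1 h2
    have hs := two_mul_le_sin_pi_mul hθ.le h3 h4
    have hw := cotWeight_mul_one_sub (t := x (n + 1) - x n) (by linarith)
    have he := expTwoPiI.add (x n) (x (n + 1) - x n)
    rw [add_sub_cancel] at he
    rw [he]
    linear_combination (-expTwoPiI (x n)) * hw
  have key : ∀ m, a ≤ m → m ≤ b →
      ‖∑ n ∈ Finset.Icc a m, expTwoPiI (x n) + c m * expTwoPiI (x (m + 1))‖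
        ≤ ‖c a‖ + ((c a).im - (c m).im) := by
    intro m ham
    induction m, ham using Nat.le_induction with
    | base =>
      intro h
      rw [Finset.Icc_self, Finset.sum_singleton, hz a le_rfl h, norm_mul, expTwoPiI.norm]
      simp
    | succ m ham ih =>
      intro h
      have ih := ih (by omega)
      rw [← Finset.insert_Icc_right_eq_Icc_add_one (by omega),
        Finset.sum_insert (by simp)]
      have e : expTwoPiI (x (m + 1)) + ∑ n ∈ Finset.Icc a m, expTwoPiI (x n)
          + c (m + 1) * expTwoPiI (x (m + 1 + 1))
          = (∑ n ∈ Finset.Icc a m, expTwoPiI (x n) + c m * expTwoPiI (x (m + 1)))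
            + (c (m + 1) - c m) * expTwoPiI (x (m + 1)) := by
        linear_combination hz (m + 1) (by omega) h
      rw [e]
      refine (norm_add_le _ _).trans ?_
      rw [norm_mul, expTwoPiI.norm, mul_one]
      have h1 := hmem m ham (by omega)
      have h2 := hmem (m + 1) (by omega) h
      have := norm_cotWeight_sub (s := x (m + 1) - x m) (t := x (m + 1 + 1) - x (m + 1))
        (by linarith) (hmono m) (by linarith)
      simp only [hc] at ih ⊢
      linarith
  have hk := key b hab le_rfl
  obtain ⟨a1, a2⟩ := hmem a le_rfl hab
  obtain ⟨b1, b2⟩ := hmem b hab le_rfl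
  obtain ⟨ha3, ha4⟩ := norm_cotWeight_le hθ a1 a2
  obtain ⟨hb3, hb4⟩ := norm_cotWeight_le hθ b1 b2
  have h := norm_sub_le (∑ n ∈ Finset.Icc a b, expTwoPiI (x n) + c b * expTwoPiI (x (b + 1)))
    (c b * expTwoPiI (x (b + 1)))
  rw [add_sub_cancel_right, norm_mul (c b), expTwoPiI.norm, mul_one] at h
  have h5 := abs_le.1 ha3
  have h6 := abs_le.1 hb3
  have h7 : 1 ≤ 1 / (2 * θ) := by
    rw [le_div_iff₀ (by positivity)]
    linarith
  have h8 : 1 / (2 * θ) = 2 * (1 / (4 * θ)) := by field_simp; norm_num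
  have h9 : 2 / θ = 8 * (1 / (4 * θ)) := by field_simp; norm_num
  simp only [hc] at *
  linarith

lemma second_difference_nonneg_of_convexOn {F : ℝ → ℝ} {s : Set ℝ} (hF : ConvexOn ℝ s F) {a h : ℝ}
    (h₀ : a ∈ s) (h₂ : a + 2 * h ∈ s) : 0 ≤ F (a + 2 * h) - 2 * F (a + h) + F a := by
  have hmid := hF.2 h₀ h₂ (show (0:ℝ) ≤ 1 / 2 by norm_num) (show (0:ℝ) ≤ 1 / 2 by norm_num) (by norm_num)
  simp only [smul_eq_mul] at hmid
  rw [show 1 / 2 * a + 1 / 2 * (a + 2 * h) = a + h by ring] at hmid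
  linarith

lemma second_difference_mem_of_iteratedDerivWithin_mem {G : ℝ → ℝ} {α β : ℝ}
    (hG : ContDiffOn ℝ 2 G (Set.Icc 0 1))
    (hG2 : ∀ t ∈ Set.Icc (0:ℝ) 1, α ≤ iteratedDerivWithin 2 G (Set.Icc 0 1) t ∧
      iteratedDerivWithin 2 G (Set.Icc 0 1) t ≤ β)
    {a h : ℝ} (h₀ : a ∈ Set.Icc (0:ℝ) 1) (h₂ : a + 2 * h ∈ Set.Icc (0:ℝ) 1) :
    α * h ^ 2 ≤ G (a + 2 * h) - 2 * G (a + h) + G a ∧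
      G (a + 2 * h) - 2 * G (a + h) + G a ≤ β * h ^ 2 := by
  have hu : UniqueDiffOn ℝ (Set.Icc (0:ℝ) 1) := uniqueDiffOn_Icc zero_lt_one
  have hint : interior (Set.Icc (0:ℝ) 1) ⊆ Set.Icc 0 1 := interior_subset
  set G' := derivWithin G (Set.Icc 0 1)
  set G'' := iteratedDerivWithin 2 G (Set.Icc 0 1)
  have hd1 : ∀ t ∈ interior (Set.Icc (0:ℝ) 1),
      HasDerivWithinAt G (G' t) (interior (Set.Icc (0:ℝ) 1)) t := fun t ht =>
    ((hG.differentiableOn (by norm_num) t (hint ht)).hasDerivWithinAt).mono hint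
  have hd2 : ∀ t ∈ interior (Set.Icc (0:ℝ) 1),
      HasDerivWithinAt G' (G'' t) (interior (Set.Icc (0:ℝ) 1)) t := by
    intro t ht
    have h1 := (hG.differentiableOn_iteratedDerivWithin (m := 1) (by norm_num) hu t
      (hint ht)).hasDerivWithinAt
    rw [← iteratedDerivWithin_succ] at h1
    exact (h1.congr_of_mem (fun y _ => congrFun iteratedDerivWithin_one.symm y) (hint ht)).mono hint
  have q1 : ∀ (c t : ℝ) (s : Set ℝ), HasDerivWithinAt (fun t => c * t ^ 2 / 2) (c * t) s t := by
    intro c t s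
    have := ((hasDerivAt_pow 2 t).const_mul (c / 2)).hasDerivWithinAt (s := s)
    convert! this using 1
    · ext; ring
    · simp; ring
  have q2 : ∀ (c t : ℝ) (s : Set ℝ), HasDerivWithinAt (fun t => c * t) c s t := by
    intro c t s
    simpa using ((hasDerivAt_id t).const_mul c).hasDerivWithinAt (s := s)
  have cvx1 : ConvexOn ℝ (Set.Icc (0:ℝ) 1) (fun t => G t - α * t ^ 2 / 2) :=
    convexOn_of_hasDerivWithinAt2_nonneg (convex_Icc 0 1)
      (hG.continuousOn.sub (by fun_prop))
      (fun t ht => (hd1 t ht).sub (q1 α t _)) (fun t ht => (hd2 t ht).sub (q2 α t _))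
      (fun t ht => by linarith [(hG2 t (hint ht)).1])
  have cvx2 : ConvexOn ℝ (Set.Icc (0:ℝ) 1) (fun t => β * t ^ 2 / 2 - G t) :=
    convexOn_of_hasDerivWithinAt2_nonneg (convex_Icc 0 1)
      (ContinuousOn.sub (by fun_prop) hG.continuousOn)
      (fun t ht => (q1 β t _).sub (hd1 t ht)) (fun t ht => (q2 β t _).sub (hd2 t ht))
      (fun t ht => by linarith [(hG2 t (hint ht)).2])
  have r1 := second_difference_nonneg_of_convexOn cvx1 h₀ h₂
  have r2 := second_difference_nonneg_of_convexOn cvx2 h₀ h₂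
  constructor <;> nlinarith

/-- A finite sequence with bounded second differences extends to an infinite one. -/
lemma exists_extension_of_second_difference_mem (x : ℕ → ℝ) {μ ν : ℝ} (hμν : μ ≤ ν) (M : ℕ)
    (h : ∀ n, n + 2 ≤ M → μ ≤ x (n + 2) - 2 * x (n + 1) + x n ∧
      x (n + 2) - 2 * x (n + 1) + x n ≤ ν) :
    ∃ y : ℕ → ℝ, (∀ n ≤ M, y n = x n) ∧ ∀ n, μ ≤ y (n + 2) - 2 * y (n + 1) + y n ∧
      y (n + 2) - 2 * y (n + 1) + y n ≤ ν := by
  set s : ℕ → ℝ := fun i => if i + 2 ≤ M then x (i + 2) - 2 * x (i + 1) + x i else μ with hs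
  set g : ℕ → ℝ := fun n => x 1 - x 0 + ∑ i ∈ Finset.range n, s i with hg
  set y : ℕ → ℝ := fun n => x 0 + ∑ j ∈ Finset.range n, g j with hy
  have hy2 : ∀ n, y (n + 2) - 2 * y (n + 1) + y n = s n := by
    intro n
    simp only [hy, hg, Finset.sum_range_succ]
    ring
  refine ⟨y, ?_, ?_⟩
  · intro n
    induction n using Nat.twoStepInduction with
    | zero => simp [hy]
    | one => simp [hy, hg]
    | more n ih1 ih2 =>
      intro hn
      have e := hy2 n
      rw [ih1 (by omega), ih2 (by omega)] at e
      simp only [hs, if_pos hn] at e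
      linarith
  · intro n
    rw [hy2]
    simp only [hs]
    split_ifs with hn
    · exact h n hn
    · exact ⟨le_rfl, hμν⟩

lemma mul_le_sub_of_le_succ_sub {g : ℕ → ℝ} {μ : ℝ} (hg : ∀ n, μ ≤ g (n + 1) - g n) {m n : ℕ}
    (hmn : m ≤ n) : ((n : ℝ) - m) * μ ≤ g n - g m := by
  induction n, hmn using Nat.le_induction with
  | base => simp
  | succ n hmn ih =>
    have := hg n
    push_cast
    linarith

lemma card_le_of_mem_Icc_of_le_succ_sub {g : ℕ → ℝ} {μ : ℝ} (hμ : 0 < μ)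
    (hg : ∀ n, μ ≤ g (n + 1) - g n) (s : Finset ℕ) {u v : ℝ} (huv : u ≤ v)
    (hs : ∀ n ∈ s, u ≤ g n ∧ g n ≤ v) : (s.card : ℝ) ≤ (v - u) / μ + 1 := by
  rcases s.eq_empty_or_nonempty with rfl | hne
  · have : 0 ≤ (v - u) / μ := div_nonneg (by linarith) hμ.le
    simp
    linarith
  · have hsub : s ⊆ Finset.Icc (s.min' hne) (s.max' hne) := fun n hn =>
      Finset.mem_Icc.2 ⟨s.min'_le n hn, s.le_max' n hn⟩
    have hle : s.min' hne ≤ s.max' hne := s.min'_le_max' hne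
    have hcard := Finset.card_le_card hsub
    rw [Nat.card_Icc] at hcard
    have hc : (s.card : ℝ) + s.min' hne ≤ s.max' hne + 1 := by
      exact_mod_cast (by omega : s.card + s.min' hne ≤ s.max' hne + 1)
    have h1 := mul_le_sub_of_le_succ_sub hg hle
    have h2 := hs _ (s.min'_mem hne)
    have h3 := hs _ (s.max'_mem hne)
    have h4 : (s.max' hne : ℝ) - s.min' hne ≤ (v - u) / μ := by
      rw [le_div_iff₀ hμ]
      linarith
    linarith

lemma norm_sum_expTwoPiI_le_card (x : ℕ → ℝ) (s : Finset ℕ) :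
    ‖∑ n ∈ s, expTwoPiI (x n)‖ ≤ s.card := by
  refine (norm_sum_le _ _).trans ?_
  simp [expTwoPiI.norm]

/-- The part of an exponential sum on which the differences have a given integer part. -/
lemma norm_sum_expTwoPiI_floor_fiber_le (x : ℕ → ℝ) {θ : ℝ} (hθ : 0 < θ) (hθ1 : θ ≤ 1)
    (hx : ∀ n, θ ^ 2 ≤ x (n + 2) - 2 * x (n + 1) + x n) (N : ℕ) (k : ℤ) :
    ‖∑ n ∈ Finset.range N with ⌊x (n + 1) - x n⌋ = k, expTwoPiI (x n)‖ ≤ 6 / θ := by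
  set g : ℕ → ℝ := fun n => x (n + 1) - x n with hg
  have hstep : ∀ n, θ ^ 2 ≤ g (n + 1) - g n := fun n => by
    have := hx n
    simp only [hg]
    linarith
  have hmono : Monotone g := monotone_nat_of_le_succ fun n => by
    have := hstep n
    nlinarith
  set F := (Finset.range N).filter fun n => ⌊g n⌋ = k
  have hF : ∀ n ∈ F, (k : ℝ) ≤ g n ∧ g n < k + 1 := fun n hn =>
    Int.floor_eq_iff.1 (Finset.mem_filter.1 hn).2
  set L := F.filter fun n => g n < k + θ
  set F' := F.filter fun n => ¬ g n < k + θ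
  set R := F'.filter fun n => k + 1 - θ < g n
  set M := F'.filter fun n => ¬ k + 1 - θ < g n with hM
  have hend : θ / θ ^ 2 + 1 ≤ 2 / θ := by
    rw [show θ / θ ^ 2 = 1 / θ by field_simp]
    have : 1 ≤ 1 / θ := by rwa [le_div_iff₀ hθ, one_mul]
    have : 2 / θ = 1 / θ + 1 / θ := by ring
    linarith
  have hL : ‖∑ n ∈ L, expTwoPiI (x n)‖ ≤ 2 / θ := by
    refine (norm_sum_expTwoPiI_le_card x L).trans (le_trans ?_ hend)
    have := card_le_of_mem_Icc_of_le_succ_sub (by positivity) hstep L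
      (u := k) (v := k + θ) (by linarith) fun n hn =>
        ⟨(hF n (Finset.mem_filter.1 hn).1).1, (Finset.mem_filter.1 hn).2.le⟩
    rwa [add_sub_cancel_left] at this
  have hR : ‖∑ n ∈ R, expTwoPiI (x n)‖ ≤ 2 / θ := by
    refine (norm_sum_expTwoPiI_le_card x R).trans (le_trans ?_ hend)
    have := card_le_of_mem_Icc_of_le_succ_sub (by positivity) hstep R
      (u := k + 1 - θ) (v := k + 1) (by linarith) fun n hn =>
        ⟨(Finset.mem_filter.1 hn).2.le,
          (hF n (Finset.mem_filter.1 (Finset.mem_filter.1 hn).1).1).2.le⟩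
    rwa [sub_sub_cancel] at this
  have hMle : ‖∑ n ∈ M, expTwoPiI (x n)‖ ≤ 2 / θ := by
    rcases M.eq_empty_or_nonempty with he | hne
    · rw [he]
      simp
      positivity
    · have hmem : ∀ n ∈ M, n < N ∧ k + θ ≤ g n ∧ g n ≤ k + 1 - θ := fun n hn => by
        obtain ⟨h1, h2⟩ := Finset.mem_filter.1 hn
        obtain ⟨h3, h4⟩ := Finset.mem_filter.1 h1
        exact ⟨Finset.mem_range.1 (Finset.mem_filter.1 h3).1, not_lt.1 h4, not_lt.1 h2⟩
      have hmin := hmem _ (M.min'_mem hne)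
      have hmax := hmem _ (M.max'_mem hne)
      have hbd : ∀ n, M.min' hne ≤ n → n ≤ M.max' hne → k + θ ≤ g n ∧ g n ≤ k + 1 - θ :=
        fun n h1 h2 => ⟨hmin.2.1.trans (hmono h1), (hmono h2).trans hmax.2.2⟩
      have hMI : M = Finset.Icc (M.min' hne) (M.max' hne) := by
        refine Finset.Subset.antisymm
          (fun n hn => Finset.mem_Icc.2 ⟨M.min'_le n hn, M.le_max' n hn⟩) fun n hn => ?_
        obtain ⟨h1, h2⟩ := Finset.mem_Icc.1 hn
        obtain ⟨h3, h4⟩ := hbd n h1 h2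
        refine Finset.mem_filter.2 ⟨Finset.mem_filter.2 ⟨Finset.mem_filter.2
          ⟨Finset.mem_range.2 (h2.trans_lt hmax.1), Int.floor_eq_iff.2 ⟨?_, ?_⟩⟩, not_lt.2 h3⟩,
          not_lt.2 h4⟩ <;> linarith
      have hkl := norm_sum_expTwoPiI_le_of_sub_mem (fun n => x n - ((k * n : ℤ) : ℝ)) hθ
        (M.min'_le_max' hne)
        (fun n => by
          have := hmono (Nat.le_succ n)
          simp only [hg] at this
          push_cast
          linarith)
        (fun n h1 h2 => by
          have := hbd n h1 h2
          simp only [hg] at this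
          push_cast
          constructor <;> linarith)
      simp only [expTwoPiI.sub_int] at hkl
      rwa [← hMI] at hkl
  rw [← Finset.sum_filter_add_sum_filter_not F (fun n => g n < k + θ),
    ← Finset.sum_filter_add_sum_filter_not (F.filter fun n => ¬ g n < k + θ)
      (fun n => k + 1 - θ < g n)]
  have h6 : 6 / θ = 2 / θ + (2 / θ + 2 / θ) := by ring
  rw [h6]
  exact (norm_add_le _ _).trans (add_le_add hL ((norm_add_le _ _).trans (add_le_add hR hMle)))

/-- Van der Corput's second derivative test. -/
lemma norm_sum_expTwoPiI_le_of_second_difference (x : ℕ → ℝ) {θ K : ℝ} (hθ : 0 < θ) (hθ1 : θ ≤ 1)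
    (hx : ∀ n, θ ^ 2 ≤ x (n + 2) - 2 * x (n + 1) + x n ∧
      x (n + 2) - 2 * x (n + 1) + x n ≤ K * θ ^ 2) (N : ℕ) :
    ‖∑ n ∈ Finset.range N, expTwoPiI (x n)‖ ≤ 6 * K * N * θ + 12 / θ := by
  have hK : 0 ≤ K := by
    have := hx 0
    have : 0 < θ ^ 2 := by positivity
    by_contra! h
    nlinarith
  set g : ℕ → ℝ := fun n => x (n + 1) - x n with hg
  have hstep : ∀ n, θ ^ 2 ≤ g (n + 1) - g n := fun n => by
    have := (hx n).1
    simp only [hg]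
    linarith
  have hmono : Monotone g := monotone_nat_of_le_succ fun n => by
    have := hstep n
    nlinarith
  have hgN : g N - g 0 ≤ K * θ ^ 2 * N := by
    have := mul_le_sub_of_le_succ_sub (g := fun n => -g n) (μ := -(K * θ ^ 2))
      (fun n => by
        have := (hx n).2
        simp only [hg]
        linarith) (Nat.zero_le N)
    push_cast at this
    linarith
  have hmaps : ∀ n ∈ Finset.range N, ⌊g n⌋ ∈ Finset.Icc ⌊g 0⌋ ⌊g N⌋ := fun n hn =>
    Finset.mem_Icc.2 ⟨Int.floor_mono (hmono (Nat.zero_le n)),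
      Int.floor_mono (hmono (Finset.mem_range.1 hn).le)⟩
  rw [← Finset.sum_fiberwise_of_maps_to hmaps]
  refine (norm_sum_le_of_le _ fun k _ =>
    norm_sum_expTwoPiI_floor_fiber_le x hθ hθ1 (fun n => (hx n).1) N k).trans ?_
  rw [Finset.sum_const, nsmul_eq_mul, Int.card_Icc]
  have hle : ⌊g 0⌋ ≤ ⌊g N⌋ := Int.floor_mono (hmono (Nat.zero_le N))
  have hcard : (((⌊g N⌋ + 1 - ⌊g 0⌋).toNat : ℕ) : ℝ) ≤ K * θ ^ 2 * N + 2 := by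
    have h1 : (((⌊g N⌋ + 1 - ⌊g 0⌋).toNat : ℤ) : ℝ) = ((⌊g N⌋ + 1 - ⌊g 0⌋ : ℤ) : ℝ) := by
      rw [Int.toNat_of_nonneg (by omega)]
    rw [Int.cast_natCast] at h1
    rw [h1]
    push_cast
    have := Int.floor_le (g N)
    have := Int.lt_floor_add_one (g 0)
    linarith
  calc _ ≤ (K * θ ^ 2 * N + 2) * (6 / θ) := mul_le_mul_of_nonneg_right hcard (by positivity)
    _ = _ := by field_simp; ring

lemma sum_range_dist_le (b : ℕ → ℝ) (hb : ∀ n, 0 ≤ b n) {H h : ℕ} (hh : h < H) :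
    ∑ j ∈ Finset.range H, b (Nat.dist h j) ≤ 2 * ∑ j ∈ Finset.range H, b j := by
  rw [← Finset.sum_range_add_sum_Ico _ hh.le]
  have h1 : ∑ j ∈ Finset.range h, b (Nat.dist h j) ≤ ∑ j ∈ Finset.range H, b j := by
    have e : ∑ j ∈ Finset.range h, b (Nat.dist h j) = ∑ j ∈ Finset.range h, b (j + 1) := by
      rw [← Finset.sum_range_reflect]
      refine Finset.sum_congr rfl fun j hj => ?_
      have := Finset.mem_range.1 hj
      rw [Nat.dist_eq_sub_of_le_right (by omega)]
      congr 1
      omega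
    have e2 := Finset.sum_range_succ' b h
    have := Finset.sum_le_sum_of_subset_of_nonneg (Finset.range_mono (by omega : h + 1 ≤ H))
      (fun i _ _ => hb i)
    have := hb 0
    linarith
  have h2 : ∑ j ∈ Finset.Ico h H, b (Nat.dist h j) ≤ ∑ j ∈ Finset.range H, b j := by
    rw [Finset.sum_Ico_eq_sum_range]
    calc _ = ∑ j ∈ Finset.range (H - h), b j := Finset.sum_congr rfl fun j _ => by
          rw [Nat.dist_eq_sub_of_le (by omega)]
          congr 1
          omega
      _ ≤ _ := Finset.sum_le_sum_of_subset_of_nonneg (Finset.range_mono (by omega))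
          (fun i _ _ => hb i)
  linarith

lemma sum_range_inv_sqrt_le (H : ℕ) : ∑ j ∈ Finset.range (H + 1), 1 / √(j : ℝ) ≤ 2 * √(H : ℝ) := by
  induction H with
  | zero => simp
  | succ H ih =>
    rw [Finset.sum_range_succ]
    have h0 : (0 : ℝ) < ((H + 1 : ℕ) : ℝ) := by positivity
    have h1 : 0 < √((H + 1 : ℕ) : ℝ) := Real.sqrt_pos.2 h0
    have h2 := Real.sq_sqrt h0.le
    have h3 := Real.sq_sqrt (Nat.cast_nonneg (α := ℝ) H)
    have h4 := Real.sqrt_nonneg (H : ℝ)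
    have h5 : 1 / √((H + 1 : ℕ) : ℝ) ≤ 2 * √((H + 1 : ℕ) : ℝ) - 2 * √(H : ℝ) := by
      rw [div_le_iff₀ h1]
      push_cast at h2 ⊢
      nlinarith [sq_nonneg (√((H : ℝ) + 1) - √(H : ℝ))]
    linarith

lemma sum_normSq_sum_expTwoPiI_le (x : ℕ → ℝ) (N H : ℕ) :
    ∑ n ∈ Finset.range N, ‖∑ h ∈ Finset.range H, expTwoPiI (h * x n)‖ ^ 2
      ≤ 2 * H * ∑ j ∈ Finset.range H, ‖∑ n ∈ Finset.range N, expTwoPiI (j * x n)‖ := by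
  set S : ℕ → ℂ := fun j => ∑ n ∈ Finset.range N, expTwoPiI (j * x n) with hS
  have hdist : ∀ h j : ℕ, ‖∑ n ∈ Finset.range N, expTwoPiI ((h - j : ℝ) * x n)‖
      = ‖S (Nat.dist h j)‖ := by
    intro h j
    rcases le_total j h with hjh | hjh
    · rw [Nat.dist_eq_sub_of_le_right hjh]
      simp only [hS, Nat.cast_sub hjh]
    · rw [Nat.dist_eq_sub_of_le hjh, ← Complex.norm_conj (S _)]
      simp only [hS, Nat.cast_sub hjh, map_sum, expTwoPiI.star_eq]
      congr 1
      refine Finset.sum_congr rfl fun n _ => ?_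
      congr 1
      ring
  have hsq : ∀ n, ((‖∑ h ∈ Finset.range H, expTwoPiI (h * x n)‖ ^ 2 : ℝ) : ℂ)
      = ∑ h ∈ Finset.range H, ∑ j ∈ Finset.range H, expTwoPiI ((h - j : ℝ) * x n) := by
    intro n
    rw [Complex.ofReal_pow, ← Complex.mul_conj', map_sum, Finset.sum_mul_sum]
    refine Finset.sum_congr rfl fun h _ => Finset.sum_congr rfl fun j _ => ?_
    rw [expTwoPiI.star_eq, ← expTwoPiI.add]
    congr 1
    ring
  have hnonneg : 0 ≤ ∑ n ∈ Finset.range N, ‖∑ h ∈ Finset.range H, expTwoPiI (h * x n)‖ ^ 2 :=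
    Finset.sum_nonneg fun _ _ => by positivity
  rw [← abs_of_nonneg hnonneg, ← Real.norm_eq_abs, ← Complex.norm_real, Complex.ofReal_sum]
  simp only [hsq]
  rw [Finset.sum_comm]
  calc _ ≤ ∑ h ∈ Finset.range H, 2 * ∑ j ∈ Finset.range H, ‖S j‖ := by
        refine norm_sum_le_of_le _ fun h hh => ?_
        rw [Finset.sum_comm]
        refine (norm_sum_le _ _).trans ?_
        simp only [hdist]
        exact sum_range_dist_le (fun j => ‖S j‖) (fun _ => norm_nonneg _) (Finset.mem_range.1 hh)
    _ = _ := by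
        rw [Finset.sum_const, Finset.card_range, nsmul_eq_mul]
        ring

lemma half_le_norm_sum_expTwoPiI {t δ : ℝ} {y : ℤ} {H : ℕ} (hy : |y - t| ≤ δ) (hH : 6 * H * δ ≤ 1) :
    (H : ℝ) / 2 ≤ ‖∑ h ∈ Finset.range H, expTwoPiI (h * t)‖ := by
  refine le_trans ?_ (Complex.re_le_norm _)
  rw [Complex.re_sum]
  have hterm : ∀ h ∈ Finset.range H, (1 / 2 : ℝ) ≤ (expTwoPiI (h * t)).re := by
    intro h hh
    have hhH : (h : ℝ) ≤ H := by exact_mod_cast (Finset.mem_range.1 hh).le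
    have hδ : 0 ≤ δ := (abs_nonneg _).trans hy
    rw [← expTwoPiI.sub_int _ (h * y), expTwoPiI.re, ← Real.cos_abs, ← Real.cos_pi_div_three]
    have hle : |2 * Real.pi * (h * t - ((h * y : ℤ) : ℝ))| ≤ Real.pi / 3 := by
      have e : 2 * Real.pi * (h * t - ((h * y : ℤ) : ℝ)) = -(2 * Real.pi * h * (y - t)) := by
        push_cast
        ring
      rw [e, abs_neg, abs_mul, abs_of_nonneg (by positivity : 0 ≤ 2 * Real.pi * h)]
      have : (h : ℝ) * |y - t| ≤ H * δ := mul_le_mul hhH hy (abs_nonneg _) (by positivity)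
      have hp := Real.pi_pos
      nlinarith
    exact Real.cos_le_cos_of_nonneg_of_le_pi (abs_nonneg _) (by linarith [Real.pi_pos]) hle
  calc (H : ℝ) / 2 = ∑ h ∈ Finset.range H, (1 / 2 : ℝ) := by simp; ring
    _ ≤ _ := Finset.sum_le_sum hterm

lemma card_near_int_le_of_sums (x : ℕ → ℝ) {μ K δ : ℝ} (hμ : 0 < μ)
    (hx : ∀ n, μ ≤ x (n + 2) - 2 * x (n + 1) + x n ∧ x (n + 2) - 2 * x (n + 1) + x n ≤ K * μ)
    (N : ℕ) {H : ℕ} (hH : 0 < H) (hHδ : 6 * H * δ ≤ 1) (hHμ : H * μ ≤ 1) (A : Finset ℕ)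
    (hAN : A ⊆ Finset.range N) (hA : ∀ n ∈ A, ∃ y : ℤ, |y - x n| ≤ δ) :
    (A.card : ℝ) ≤ 8 * N / H + 48 * K * N * √(H * μ) + 192 / √(H * μ) := by
  have hK : 0 ≤ K := by
    have := hx 0
    by_contra! h
    nlinarith
  have hHr : (0 : ℝ) < H := by exact_mod_cast hH
  have hlow : (A.card : ℝ) * (H / 2) ^ 2
      ≤ ∑ n ∈ Finset.range N, ‖∑ h ∈ Finset.range H, expTwoPiI (h * x n)‖ ^ 2 := by
    refine le_trans ?_ (Finset.sum_le_sum_of_subset_of_nonneg hAN fun _ _ _ => by positivity)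
    rw [← nsmul_eq_mul]
    refine Finset.card_nsmul_le_sum _ _ _ fun n hn => ?_
    obtain ⟨y, hy⟩ := hA n hn
    exact pow_le_pow_left₀ (by positivity) (half_le_norm_sum_expTwoPiI hy hHδ) 2
  have hS : ∀ j ∈ Finset.range H, ‖∑ n ∈ Finset.range N, expTwoPiI (j * x n)‖
      ≤ (if j = 0 then (N : ℝ) else 0) + 6 * K * N * √(H * μ) + 12 / √μ * (1 / √(j : ℝ)) := by
    intro j hj
    have hjH : (j : ℝ) ≤ H := by exact_mod_cast (Finset.mem_range.1 hj).le
    split_ifs with h0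
    · subst h0
      refine (norm_sum_expTwoPiI_le_card _ _).trans ?_
      simp
      positivity
    · have hj0 : (0 : ℝ) < j := by exact_mod_cast Nat.pos_of_ne_zero h0
      have hjμ : (j : ℝ) * μ ≤ H * μ := mul_le_mul_of_nonneg_right hjH hμ.le
      have hsq : √(j * μ) ^ 2 = j * μ := Real.sq_sqrt (by positivity)
      have hv := norm_sum_expTwoPiI_le_of_second_difference (fun n => j * x n) (θ := √(j * μ))
        (K := K) (Real.sqrt_pos.2 (by positivity))
        (Real.sqrt_le_one.2 (hjμ.trans hHμ)) (fun n => by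
          rw [hsq]
          have := hx n
          constructor <;> nlinarith) N
      have h1 : 6 * K * N * √(j * μ) ≤ 6 * K * N * √(H * μ) :=
        mul_le_mul_of_nonneg_left (Real.sqrt_le_sqrt hjμ) (by positivity)
      have h2 : 12 / √(j * μ) = 12 / √μ * (1 / √(j : ℝ)) := by
        rw [Real.sqrt_mul hj0.le]
        field_simp
      linarith
  have hsum : ∑ j ∈ Finset.range H, ‖∑ n ∈ Finset.range N, expTwoPiI (j * x n)‖
      ≤ N + H * (6 * K * N * √(H * μ)) + 12 / √μ * (2 * √(H : ℝ)) := by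
    refine (Finset.sum_le_sum hS).trans ?_
    rw [Finset.sum_add_distrib, Finset.sum_add_distrib]
    have h1 : ∑ j ∈ Finset.range H, 1 / √(j : ℝ) ≤ 2 * √(H : ℝ) :=
      (Finset.sum_le_sum_of_subset_of_nonneg (Finset.range_mono (Nat.le_succ H))
        fun _ _ _ => by positivity).trans (sum_range_inv_sqrt_le H)
    have h2 : ∑ j ∈ Finset.range H, (if j = 0 then (N : ℝ) else 0) ≤ N := by
      rw [Finset.sum_ite_eq' (Finset.range H) 0]
      simp [hH]
    rw [Finset.sum_const, Finset.card_range, nsmul_eq_mul]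
    have h3 := mul_le_mul_of_nonneg_left h1 (by positivity : 0 ≤ 12 / √μ)
    rw [Finset.mul_sum] at h3
    linarith
  have hfin : (A.card : ℝ) * (H / 2) ^ 2
      ≤ 2 * H * (N + H * (6 * K * N * √(H * μ)) + 12 / √μ * (2 * √(H : ℝ))) :=
    hlow.trans ((sum_normSq_sum_expTwoPiI_le x N H).trans
      (mul_le_mul_of_nonneg_left hsum (by positivity)))
  have hsH : 0 < √(H : ℝ) := Real.sqrt_pos.2 hHr
  have hsμ : 0 < √μ := Real.sqrt_pos.2 hμ
  refine le_of_mul_le_mul_right (hfin.trans (le_of_eq ?_)) (by positivity : 0 < ((H : ℝ) / 2) ^ 2)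
  rw [Real.sqrt_mul hHr.le]
  have e : (H : ℝ) = √(H : ℝ) ^ 2 := (Real.sq_sqrt hHr.le).symm
  set r := √(H : ℝ)
  rw [e]
  field_simp
  ring

/-- A count of the terms near integers in a sequence with second differences of size `μ`. -/
lemma card_near_int_le (x : ℕ → ℝ) {μ K δ T : ℝ} (hμ : 0 < μ)
    (hx : ∀ n, μ ≤ x (n + 2) - 2 * x (n + 1) + x n ∧ x (n + 2) - 2 * x (n + 1) + x n ≤ K * μ)
    (N : ℕ) (hT : 0 < T) (hT6 : T ≤ 1 / 6) (hδT : δ ≤ T) (hμT : μ ≤ T ^ 3) (A : Finset ℕ)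
    (hAN : A ⊆ Finset.range N) (hA : ∀ n ∈ A, ∃ y : ℤ, |y - x n| ≤ δ) :
    (A.card : ℝ) ≤ (96 + 48 * K) * (N * T) + 768 * √(T / μ) := by
  have hK : 0 ≤ K := by
    have := hx 0
    by_contra! h
    nlinarith
  set H := ⌊1 / (6 * T)⌋₊
  have hone : 1 ≤ 1 / (6 * T) := by
    rw [le_div_iff₀ (by positivity)]
    linarith
  have hH : 0 < H := Nat.floor_pos.2 hone
  have hH1 : (1 : ℝ) ≤ H := by exact_mod_cast hH
  have hHle : (H : ℝ) ≤ 1 / (6 * T) := Nat.floor_le (by positivity)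
  have hHgt : 1 / (6 * T) < H + 1 := Nat.lt_floor_add_one _
  rw [le_div_iff₀ (by positivity)] at hHle
  rw [div_lt_iff₀ (by positivity)] at hHgt
  have hHT : 1 ≤ 12 * T * H := by nlinarith
  have hHμ : H * μ ≤ T ^ 2 := by
    have h1 : (H : ℝ) * μ ≤ H * T ^ 3 := mul_le_mul_of_nonneg_left hμT (by positivity)
    have h2 : (H : ℝ) * T ^ 3 = (H * T) * T ^ 2 := by ring
    have h3 : (H * T) * T ^ 2 ≤ 1 * T ^ 2 :=
      mul_le_mul_of_nonneg_right (by linarith) (by positivity)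
    linarith
  have hc := card_near_int_le_of_sums x (δ := δ) hμ hx N hH (by nlinarith) (by nlinarith) A hAN hA
  have h1 : 8 * N / H ≤ 96 * (N * T) := by
    rw [div_le_iff₀ (by positivity)]
    have := mul_le_mul_of_nonneg_left hHT (by positivity : (0 : ℝ) ≤ 8 * N)
    linarith
  have h2 : 48 * K * N * √(H * μ) ≤ 48 * K * N * T :=
    mul_le_mul_of_nonneg_left (Real.sqrt_le_iff.2 ⟨hT.le, hHμ⟩) (by positivity)
  have h3 : 192 / √(H * μ) ≤ 768 * √(T / μ) := by
    have hpos : 0 < √(H * μ) := Real.sqrt_pos.2 (by positivity)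
    rw [div_le_iff₀ hpos, mul_assoc, ← Real.sqrt_mul (by positivity)]
    have : 1 / 4 ≤ √(T / μ * (H * μ)) := by
      apply Real.le_sqrt_of_sq_le
      rw [show T / μ * (H * μ) = T * H by field_simp]
      linarith
    linarith
  linarith

/-- Each abscissa carries at most `2δ + 1` integer points within `δ` of the curve. -/
lemma ncard_near_curve_le (c : ℕ → ℝ) {δ : ℝ} (hδ : 0 ≤ δ) (S : Set (ℤ × ℤ)) (A : Finset ℕ)
    (hS : ∀ q ∈ S, ∃ n ∈ A, q.1 = n ∧ |q.2 - c n| ≤ δ) :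
    (S.ncard : ℝ) ≤ A.card * (2 * δ + 1) := by
  classical
  set B : Finset (ℤ × ℤ) := A.biUnion fun n =>
    (Finset.Icc ⌈c n - δ⌉ ⌊c n + δ⌋).image fun y => ((n : ℤ), y)
  have hSB : S ⊆ B := by
    rintro ⟨a, b⟩ hq
    obtain ⟨n, hn, h1, h2⟩ := hS _ hq
    obtain ⟨h3, h4⟩ := abs_le.1 h2
    refine Finset.mem_coe.2 (Finset.mem_biUnion.2 ⟨n, hn, Finset.mem_image.2 ⟨b, ?_, ?_⟩⟩)
    · exact Finset.mem_Icc.2 ⟨Int.ceil_le.2 (by linarith), Int.le_floor.2 (by linarith)⟩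
    · exact Prod.ext h1.symm rfl
  have h1 : S.ncard ≤ B.card := by
    rw [← Set.ncard_coe_finset]
    exact Set.ncard_le_ncard hSB B.finite_toSet
  have h2 : B.card ≤ ∑ n ∈ A, (⌊c n + δ⌋ + 1 - ⌈c n - δ⌉).toNat :=
    Finset.card_biUnion_le.trans (Finset.sum_le_sum fun n _ =>
      Finset.card_image_le.trans (Int.card_Icc _ _).le)
  have h3 : ∀ n ∈ A, (((⌊c n + δ⌋ + 1 - ⌈c n - δ⌉).toNat : ℕ) : ℝ) ≤ 2 * δ + 1 := by
    intro n _
    have h4 := Int.floor_le (c n + δ)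
    have h5 := Int.le_ceil (c n - δ)
    rcases le_total 0 (⌊c n + δ⌋ + 1 - ⌈c n - δ⌉) with h | h
    · have e : (((⌊c n + δ⌋ + 1 - ⌈c n - δ⌉).toNat : ℤ) : ℝ)
          = ((⌊c n + δ⌋ + 1 - ⌈c n - δ⌉ : ℤ) : ℝ) := by rw [Int.toNat_of_nonneg h]
      rw [Int.cast_natCast] at e
      rw [e]
      push_cast
      linarith
    · rw [Int.toNat_of_nonpos h]
      simp
      linarith
  calc (S.ncard : ℝ) ≤ ((∑ n ∈ A, (⌊c n + δ⌋ + 1 - ⌈c n - δ⌉).toNat : ℕ) : ℝ) := by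
        exact_mod_cast h1.trans h2
    _ ≤ ∑ n ∈ A, (2 * δ + 1) := by
        rw [Nat.cast_sum]
        exact Finset.sum_le_sum h3
    _ = _ := by rw [Finset.sum_const, nsmul_eq_mul]

/-- For negative bases, `Real.rpow` to the power `1/3` carries the factor `cos (π / 3) = 1 / 2`. -/
lemma abs_rpow_one_third_le (z : ℝ) : |z| ^ ((1:ℝ) / 3) ≤ 2 * z ^ ((1:ℝ) / 3) := by
  rcases le_or_gt 0 z with hz | hz
  · rw [abs_of_nonneg hz]
    have := Real.rpow_nonneg hz (1 / 3)
    linarith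
  · rw [Real.rpow_def_of_neg hz, Real.rpow_def_of_pos (abs_pos.2 hz.ne), Real.log_abs,
      show (1:ℝ) / 3 * Real.pi = Real.pi / 3 by ring, Real.cos_pi_div_three]
    linarith

lemma rpow_one_third_pow_three {z : ℝ} (hz : 0 ≤ z) : (z ^ ((1:ℝ) / 3)) ^ 3 = z := by
  rw [← Real.rpow_natCast, ← Real.rpow_mul hz]
  norm_num

theorem statement7 (α β : ℝ) (hα : 0 < α) (hαβ : α < β) :
    ∃ C : ℝ, 0 < C ∧
      ∀ G : ℝ → ℝ, ContDiffOn ℝ 2 G (Set.Icc 0 1) →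
        (∀ t ∈ Set.Icc (0:ℝ) 1,
          α ≤ iteratedDerivWithin 2 G (Set.Icc 0 1) t ∧
          iteratedDerivWithin 2 G (Set.Icc 0 1) t ≤ β) →
        ∀ X Y δ : ℝ, 1 ≤ X → X ≤ Y ^ 2 → 0 < δ →
          (({q : ℤ × ℤ | 0 ≤ q.1 ∧ (q.1 : ℝ) ≤ X ∧
              |(q.2 : ℝ) - Y * G ((q.1 : ℝ) / X)| ≤ δ}).ncard : ℝ)
            ≤ C * (δ * X + (X * Y) ^ ((1:ℝ) / 3)) := by
  classical
  have hβ : 0 < β := hα.trans hαβ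
  set a := α ^ ((1:ℝ) / 3)
  have ha : 0 < a := Real.rpow_pos_of_pos hα _
  have ha3 : a ^ 3 = α := rpow_one_third_pow_three hα.le
  set D := 1 / √(α * a) with hD
  set C₀ := 16 + 4 * (96 + 48 * (β / α)) + 1536 * D with hC₀
  have hC₀pos : 0 < C₀ := by positivity
  refine ⟨C₀ * (1 + 2 * a), by positivity, ?_⟩
  intro G hG hG2 X Y δ hX hXY hδ
  have hX0 : 0 < X := by linarith
  have hY0 : Y ≠ 0 := by
    rintro rfl
    norm_num at hXY
    linarith
  set W := |Y| with hW
  have hW0 : 0 < W := abs_pos.2 hY0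
  have hXW : X ≤ W ^ 2 := by rwa [hW, sq_abs]
  set μ := α * (W / X ^ 2) with hμ
  have hμ0 : 0 < μ := by positivity
  set m := μ ^ ((1:ℝ) / 3)
  have hm : 0 < m := Real.rpow_pos_of_pos hμ0 _
  have hm3 : m ^ 3 = μ := rpow_one_third_pow_three hμ0.le
  obtain ⟨x, hxeq, hx⟩ := exists_extension_of_second_difference_mem
    (fun n : ℕ => W * G (n / X)) (μ := μ) (ν := β / α * μ)
    (le_mul_of_one_le_left hμ0.le (by rw [le_div_iff₀ hα]; linarith)) ⌊X⌋₊ (by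
      intro n hn
      have hnX : ((n + 2 : ℕ) : ℝ) ≤ X := (Nat.le_floor_iff hX0.le).1 hn
      have e1 : (n : ℝ) / X + 2 * (1 / X) = ((n + 2 : ℕ) : ℝ) / X := by push_cast; ring
      have hs := second_difference_mem_of_iteratedDerivWithin_mem hG hG2 (a := n / X) (h := 1 / X)
        ⟨by positivity, by rw [div_le_one hX0]; push_cast at hnX; linarith⟩
        ⟨by positivity, by rwa [e1, div_le_one hX0]⟩
      have e2 : (n : ℝ) / X + 1 / X = ((n + 1 : ℕ) : ℝ) / X := by push_cast; ring
      rw [e1, e2] at hs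
      have e3 : μ = W * (α * (1 / X) ^ 2) := by rw [hμ]; ring
      have e4 : β / α * μ = W * (β * (1 / X) ^ 2) := by rw [hμ]; field_simp
      rw [e4]
      nth_rewrite 1 [e3]
      have h1 := mul_le_mul_of_nonneg_left hs.1 hW0.le
      have h2 := mul_le_mul_of_nonneg_left hs.2 hW0.le
      constructor <;> linarith)
  set A := (Finset.range (⌊X⌋₊ + 1)).filter fun n => ∃ y : ℤ, |y - x n| ≤ δ
  have hN : ((⌊X⌋₊ + 1 : ℕ) : ℝ) ≤ 2 * X := by
    have := Nat.floor_le hX0.le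
    push_cast
    linarith
  have hS := ncard_near_curve_le (fun n : ℕ => Y * G (n / X)) hδ.le
    {q : ℤ × ℤ | 0 ≤ q.1 ∧ (q.1 : ℝ) ≤ X ∧ |(q.2 : ℝ) - Y * G ((q.1 : ℝ) / X)| ≤ δ} A (by
      rintro ⟨p, q⟩ ⟨h1, h2, h3⟩
      dsimp only at h1 h2 h3
      lift p to ℕ using h1
      rw [Int.cast_natCast] at h2 h3
      have hpX : p ≤ ⌊X⌋₊ := Nat.le_floor h2
      refine ⟨p, Finset.mem_filter.2 ⟨Finset.mem_range.2 (by omega), ?_⟩, rfl, h3⟩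
      rw [hxeq p hpX]
      rcases abs_choice Y with hY | hY
      · exact ⟨q, by rw [hW, hY]; exact h3⟩
      · refine ⟨-q, ?_⟩
        rw [hW, hY, ← abs_neg]
        push_cast
        convert h3 using 2
        ring)
  set T := δ + m with hT
  have hT0 : 0 < T := by positivity
  have hmain : (A.card : ℝ) * (2 * δ + 1) ≤ C₀ * (X * T) := by
    have hD0 : 0 < D := by positivity
    have hKpos : 0 < β / α := by positivity
    have hXT : 0 < X * T := by positivity
    rcases le_or_gt T (1 / 6) with h | h
    · have hcard := card_near_int_le x (δ := δ) hμ0 hx (⌊X⌋₊ + 1) hT0 h (by linarith)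
        (by rw [← hm3]; exact pow_le_pow_left₀ hm.le (by linarith) 3) A (Finset.filter_subset _ _)
        (fun n hn => (Finset.mem_filter.1 hn).2)
      have hWm : a ≤ W * m := by
        refine le_of_pow_le_pow_left₀ (n := 3) (by norm_num) (by positivity) ?_
        rw [mul_pow, hm3, ha3, hμ]
        have : X ^ 2 ≤ W ^ 4 := by
          calc X ^ 2 ≤ (W ^ 2) ^ 2 := pow_le_pow_left₀ hX0.le hXW 2
            _ = W ^ 4 := by ring
        rw [show W ^ 3 * (α * (W / X ^ 2)) = α * (W ^ 4 / X ^ 2) by ring]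
        exact le_mul_of_one_le_right hα.le ((one_le_div (by positivity)).2 this)
      have hsq : √(T / μ) ≤ D * (X * T) := by
        rw [Real.sqrt_le_left (by positivity), mul_pow, hD, div_pow, one_pow,
          Real.sq_sqrt (by positivity), div_le_iff₀ hμ0]
        have h1 : α * a ≤ α * (W * T) :=
          mul_le_mul_of_nonneg_left (hWm.trans
            (mul_le_mul_of_nonneg_left (by linarith) hW0.le)) hα.le
        have e : 1 / (α * a) * (X * T) ^ 2 * μ = T * (α * (W * T)) / (α * a) := by
          rw [hμ]
          field_simp
        rw [e, le_div_iff₀ (by positivity)]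
        exact mul_le_mul_of_nonneg_left h1 hT0.le
      have hNT : ((⌊X⌋₊ + 1 : ℕ) : ℝ) * T ≤ 2 * (X * T) := by
        have := mul_le_mul_of_nonneg_right hN hT0.le
        linarith
      have hcard2 : (A.card : ℝ) ≤ (96 + 48 * (β / α)) * (2 * (X * T)) + 768 * (D * (X * T)) :=
        hcard.trans (add_le_add (mul_le_mul_of_nonneg_left hNT (by positivity))
          (mul_le_mul_of_nonneg_left hsq (by norm_num)))
      calc (A.card : ℝ) * (2 * δ + 1) ≤ A.card * 2 :=
            mul_le_mul_of_nonneg_left (by linarith) (by positivity)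
        _ ≤ C₀ * (X * T) := by
            rw [hC₀]
            linarith
    · have hAcard : (A.card : ℝ) ≤ 2 * X := by
        refine le_trans ?_ hN
        have := Finset.card_filter_le (Finset.range (⌊X⌋₊ + 1)) fun n => ∃ y : ℤ, |y - x n| ≤ δ
        rw [Finset.card_range] at this
        exact_mod_cast this
      calc (A.card : ℝ) * (2 * δ + 1) ≤ 2 * X * (8 * T) :=
            mul_le_mul hAcard (by linarith) (by positivity) (by positivity)
        _ = 16 * (X * T) := by ring
        _ ≤ C₀ * (X * T) := by
            refine mul_le_mul_of_nonneg_right ?_ hXT.le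
            rw [hC₀]
            have : 0 < 4 * (96 + 48 * (β / α)) + 1536 * D := by positivity
            linarith
  have hXm : X * m ≤ 2 * a * (X * Y) ^ ((1:ℝ) / 3) := by
    have h1 : X * m = a * |X * Y| ^ ((1:ℝ) / 3) := by
      refine (pow_left_inj₀ (by positivity) (by positivity) (n := 3) (by norm_num)).1 ?_
      rw [mul_pow, mul_pow, hm3, ha3, rpow_one_third_pow_three (abs_nonneg _), abs_mul,
        abs_of_pos hX0, ← hW, hμ]
      field_simp
    have h2 := mul_le_mul_of_nonneg_left (abs_rpow_one_third_le (X * Y)) ha.le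
    linarith
  have hR : 0 ≤ (X * Y) ^ ((1:ℝ) / 3) := by
    have h1 := abs_rpow_one_third_le (X * Y)
    have h2 : 0 ≤ |X * Y| ^ ((1:ℝ) / 3) := by positivity
    linarith
  refine hS.trans (hmain.trans ?_)
  rw [mul_assoc]
  refine mul_le_mul_of_nonneg_left ?_ hC₀pos.le
  have h1 : 0 ≤ 2 * a * (δ * X) := by positivity
  rw [hT]
  linarith
end

section
/- There exists a constant C depending only on the matrix A such that the following holds. Let T be a separated family of caps (centers pairwise at distance ≥ √(λδ) on {Q = λ²}), let w₀ ∈ ℤ³ be nonzero and let s ≥ 1 be an integer. Then the number of caps θ in the family such that Λ_θ has rank 2, 2^s ≤ N_θ < 2^{s+1}, and u × v ∈ {w₀, −w₀} for some (equivalently, any) ℤ-basis (u, v) of Λ_θ, is at most C (λδ 2^{−s} / |w₀|)². -/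
open Matrix

/-- The quadratic form `Q(x) = xᵀ A x`. -/
noncomputable def Qform (A : Matrix (Fin 3) (Fin 3) ℝ) (x : Fin 3 → ℝ) : ℝ :=
  ∑ i, ∑ j, A i j * x i * x j

/-- The Euclidean norm on `ℝ³`. -/
noncomputable def enorm3 (x : Fin 3 → ℝ) : ℝ := Real.sqrt (∑ i, x i ^ 2)

/-- Coercion of an integer vector to a real vector. -/
def intCast3 (k : Fin 3 → ℤ) : Fin 3 → ℝ := fun i => (k i : ℝ)

/-- The set of lattice points in the cap of the shell `S_{λ,δ}` centered at `x₀`. -/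
def capLattice (A : Matrix (Fin 3) (Fin 3) ℝ) (lam δ : ℝ) (x₀ : Fin 3 → ℝ) :
    Set (Fin 3 → ℤ) :=
  {k | |Real.sqrt (Qform A (intCast3 k)) - lam| < δ ∧
       enorm3 (intCast3 k - x₀) < Real.sqrt (lam * δ)}

/-- `N_θ`, the number of lattice points in the cap centered at `x₀`. -/
noncomputable def Ncap (A : Matrix (Fin 3) (Fin 3) ℝ) (lam δ : ℝ) (x₀ : Fin 3 → ℝ) : ℕ :=
  (capLattice A lam δ x₀).ncard

/-- `Λ_θ`, the subgroup of `ℤ³` generated by differences of lattice points of the cap. -/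
def capSpan (A : Matrix (Fin 3) (Fin 3) ℝ) (lam δ : ℝ) (x₀ : Fin 3 → ℝ) :
    Submodule ℤ (Fin 3 → ℤ) :=
  Submodule.span ℤ
    {d | ∃ y ∈ capLattice A lam δ x₀, ∃ z ∈ capLattice A lam δ x₀, d = y - z}

/-- A subset of `ℝ³` is an affine line. -/
def IsAffineLine (L : Set (Fin 3 → ℝ)) : Prop :=
  ∃ pt d : Fin 3 → ℝ, d ≠ 0 ∧ L = {x | ∃ t : ℝ, x = pt + t • d}

theorem card_le_of_separated {ι : Type*} (P : Finset ι) (f g : ι → ℝ) {a b R S : ℝ}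
    (ha : 0 < a) (hb : 0 < b) (hR : 0 ≤ R) (hS : 0 ≤ S)
    (hf : ∀ p ∈ P, ∀ q ∈ P, |f p - f q| ≤ R) (hg : ∀ p ∈ P, ∀ q ∈ P, |g p - g q| ≤ S)
    (hsep : ∀ p ∈ P, ∀ q ∈ P, p ≠ q → a ≤ |f p - f q| ∨ b ≤ |g p - g q|) :
    (P.card : ℝ) ≤ (2 * R / a + 2) * (2 * S / b + 2) := by
  rcases P.eq_empty_or_nonempty with rfl | ⟨o, ho⟩
  · simp only [Finset.card_empty, Nat.cast_zero]; positivity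
  have card_Icc : ∀ t : ℝ, 0 ≤ t →
      ((Finset.Icc (-⌈t⌉) ⌊t⌋).card : ℝ) ≤ 2 * t + 2 := by
    intro t ht
    have h0 : 0 ≤ ⌊t⌋ := Int.floor_nonneg.2 ht
    have h1 : 0 ≤ ⌈t⌉ := Int.ceil_nonneg ht
    have h2 : ((Finset.Icc (-⌈t⌉) ⌊t⌋).card : ℤ) = ⌊t⌋ + 1 + ⌈t⌉ := by
      rw [Int.card_Icc, Int.toNat_of_nonneg] <;> lia
    have h3 : ((Finset.Icc (-⌈t⌉) ⌊t⌋).card : ℝ) = ⌊t⌋ + 1 + ⌈t⌉ := by exact_mod_cast h2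
    rw [h3]
    linarith [Int.floor_le t, Int.ceil_lt_add_one t]
  have mem_Icc : ∀ {t c e : ℝ}, 0 < e → |t| ≤ c → ⌊t / e⌋ ∈ Finset.Icc (-⌈c / e⌉) ⌊c / e⌋ := by
    intro t c e he h
    rw [Finset.mem_Icc]
    constructor
    · rw [Int.le_floor]
      push_cast
      have : -(c / e) ≤ t / e := by
        rw [← neg_div]; gcongr; exact (abs_le.1 h).1
      linarith [Int.le_ceil (c / e)]
    · gcongr; exact (abs_le.1 h).2
  have floor_ne : ∀ {s t e : ℝ}, 0 < e → e ≤ |s - t| → ∀ c, ⌊(s - c) / e⌋ ≠ ⌊(t - c) / e⌋ := by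
    intro s t e he h c heq
    have := Int.abs_sub_lt_one_of_floor_eq_floor heq
    rw [← sub_div, sub_sub_sub_cancel_right, abs_div, abs_of_pos he, div_lt_one he] at this
    linarith
  have hcard := Finset.card_le_card_of_injOn
    (s := P) (t := Finset.Icc (-⌈R / a⌉) ⌊R / a⌋ ×ˢ Finset.Icc (-⌈S / b⌉) ⌊S / b⌋)
    (fun p => (⌊(f p - f o) / a⌋, ⌊(g p - g o) / b⌋))
    (fun p hp => Finset.mem_coe.2 (Finset.mem_product.2
      ⟨mem_Icc ha (hf p hp o ho), mem_Icc hb (hg p hp o ho)⟩))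
    (by
      intro p hp q hq hpq
      by_contra hne
      rw [Prod.mk.injEq] at hpq
      rcases hsep p hp q hq hne with h | h
      · exact floor_ne ha h _ hpq.1
      · exact floor_ne hb h _ hpq.2)
  rw [Finset.card_product] at hcard
  refine (Nat.cast_le.2 hcard).trans ?_
  rw [Nat.cast_mul, mul_div_assoc, mul_div_assoc]
  gcongr
  · exact card_Icc _ (by positivity)
  · exact card_Icc _ (by positivity)

theorem card_mul_le_of_shortest_difference {ι : Type*} (P : Finset ι) (x y : ι → ℝ) {d : ℝ}
    (hd : 0 < d)
    (hx : ∀ p ∈ P, ∀ q ∈ P, |x p - x q| ≤ 1) (hy : ∀ p ∈ P, ∀ q ∈ P, |y p - y q| ≤ 1)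
    {e e' : ι} (he : e ∈ P) (he' : e' ∈ P)
    (hmin : ∀ p ∈ P, ∀ q ∈ P, p ≠ q → |x e - x e'| ≤ max |x p - x q| |y p - y q|)
    (hmax : |y e - y e'| ≤ |x e - x e'|)
    (hdet : ∀ p ∈ P, ∀ q ∈ P,
      (x e - x e') * (y p - y q) - (y e - y e') * (x p - x q) = 0 ∨
      d ≤ |(x e - x e') * (y p - y q) - (y e - y e') * (x p - x q)|)
    (hnc : ∃ z ∈ P, (x e - x e') * (y z - y e') - (y e - y e') * (x z - x e') ≠ 0) :
    P.card * d ≤ 32 := by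
  set X := x e - x e'
  set Y := y e - y e'
  have hbd : ∀ p ∈ P, ∀ q ∈ P, |X * (y p - y q) - Y * (x p - x q)| ≤ 2 * |X| := by
    intro p hp q hq
    calc _ ≤ |X * (y p - y q)| + |Y * (x p - x q)| := abs_sub _ _
      _ ≤ |X| * 1 + |X| * 1 := by
        rw [abs_mul, abs_mul]
        gcongr
        · exact hy p hp q hq
        · exact hx p hp q hq
      _ = _ := by ring
  obtain ⟨z, hz, hz0⟩ := hnc
  have hdX : d ≤ 2 * |X| := ((hdet z hz e' he').resolve_left hz0).trans (hbd z hz e' he')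
  have hX : 0 < |X| := by linarith
  have hX1 : |X| ≤ 1 := hx e he e' he'
  have key := card_le_of_separated P (fun p => X * y p - Y * x p) x (R := 2 * |X|) (S := 1)
    hd hX (by positivity) zero_le_one
    (fun p hp q hq => by
      convert hbd p hp q hq using 2; ring) hx
    (by
      intro p hp q hq hpq
      have heq : X * y p - Y * x p - (X * y q - Y * x q) = X * (y p - y q) - Y * (x p - x q) := by
        ring
      rw [heq]
      refine (hdet p hp q hq).symm.imp_right fun h => ?_
      have h1 : |X| * |y p - y q| ≤ |X| * |x p - x q| := by
        rw [← abs_mul, sub_eq_zero.1 h, abs_mul]; gcongr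
      have h2 := le_of_mul_le_mul_left h1 hX
      simpa [max_eq_left h2] using hmin p hp q hq hpq)
  have h1 : 2 * (2 * |X|) / d + 2 ≤ 8 * |X| / d := by
    rw [div_add' _ _ _ hd.ne']; gcongr; linarith
  have h2 : 2 * 1 / |X| + 2 ≤ 4 / |X| := by
    rw [div_add' _ _ _ hX.ne']; gcongr; linarith
  calc P.card * d ≤ (8 * |X| / d * (4 / |X|)) * d := by
        gcongr; exact key.trans (by gcongr)
    _ = 32 := by field_simp; norm_num

theorem card_mul_le_of_noncollinear {ι : Type*} (P : Finset ι) (x y : ι → ℝ) {d : ℝ} (hd : 0 < d)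
    (hx : ∀ p ∈ P, ∀ q ∈ P, |x p - x q| ≤ 1) (hy : ∀ p ∈ P, ∀ q ∈ P, |y p - y q| ≤ 1)
    (hdet : ∀ p ∈ P, ∀ q ∈ P, ∀ p' ∈ P, ∀ q' ∈ P,
      (x p - x q) * (y p' - y q') - (y p - y q) * (x p' - x q') = 0 ∨
      d ≤ |(x p - x q) * (y p' - y q') - (y p - y q) * (x p' - x q')|)
    (hnc : ∀ p ∈ P, ∀ q ∈ P, p ≠ q →
      ∃ z ∈ P, (x p - x q) * (y z - y q) - (y p - y q) * (x z - x q) ≠ 0)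
    (hP : 2 ≤ P.card) :
    P.card * d ≤ 32 := by
  classical
  obtain ⟨a, ha, b, hb, hab⟩ := Finset.one_lt_card.1 hP
  obtain ⟨⟨e, e'⟩, he, hmin⟩ := Finset.exists_min_image P.offDiag
    (fun t => max |x t.1 - x t.2| |y t.1 - y t.2|) ⟨(a, b), Finset.mem_offDiag.2 ⟨ha, hb, hab⟩⟩
  obtain ⟨he, he', hne⟩ := Finset.mem_offDiag.1 he
  have hmin' : ∀ p ∈ P, ∀ q ∈ P, p ≠ q →
      max |x e - x e'| |y e - y e'| ≤ max |x p - x q| |y p - y q| :=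
    fun p hp q hq hpq => hmin (p, q) (Finset.mem_offDiag.2 ⟨hp, hq, hpq⟩)
  rcases le_total |y e - y e'| |x e - x e'| with h | h
  · rw [max_eq_left h] at hmin'
    exact card_mul_le_of_shortest_difference P x y hd hx hy he he' hmin' h
      (hdet e he e' he') (hnc e he e' he' hne)
  · rw [max_eq_right h] at hmin'
    refine card_mul_le_of_shortest_difference P y x hd hy hx he he'
      (fun p hp q hq hpq => max_comm |x p - x q| _ ▸ hmin' p hp q hq hpq) h
      (fun p hp q hq => ?_) ?_
    · rw [← neg_sub, abs_neg, neg_eq_zero]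
      exact hdet e he e' he' p hp q hq
    · obtain ⟨z, hz, h0⟩ := hnc e he e' he' hne
      exact ⟨z, hz, by rwa [← neg_sub, neg_ne_zero]⟩

theorem enorm3_eq_norm (x : Fin 3 → ℝ) : enorm3 x = ‖WithLp.toLp 2 x‖ := by
  simp [enorm3, EuclideanSpace.norm_eq]

theorem enorm3_nonneg (x : Fin 3 → ℝ) : 0 ≤ enorm3 x := Real.sqrt_nonneg _

theorem enorm3_sq (x : Fin 3 → ℝ) : enorm3 x ^ 2 = x ⬝ᵥ x := by
  rw [enorm3, Real.sq_sqrt (by positivity)]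
  simp [dotProduct, sq]

theorem enorm3_pos {x : Fin 3 → ℝ} (hx : x ≠ 0) : 0 < enorm3 x := by
  rw [enorm3_eq_norm]
  exact norm_pos_iff.2 (by simpa using hx)

theorem enorm3_add_le (x y : Fin 3 → ℝ) : enorm3 (x + y) ≤ enorm3 x + enorm3 y := by
  simp only [enorm3_eq_norm, WithLp.toLp_add]
  exact norm_add_le _ _

theorem enorm3_sub_le (x y : Fin 3 → ℝ) : enorm3 (x - y) ≤ enorm3 x + enorm3 y := by
  simp only [enorm3_eq_norm, WithLp.toLp_sub]
  exact norm_sub_le _ _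

theorem enorm3_smul (c : ℝ) (x : Fin 3 → ℝ) : enorm3 (c • x) = |c| * enorm3 x := by
  simp only [enorm3_eq_norm, WithLp.toLp_smul, norm_smul, Real.norm_eq_abs]

theorem abs_apply_le_enorm3 (x : Fin 3 → ℝ) (i : Fin 3) : |x i| ≤ enorm3 x := by
  rw [enorm3_eq_norm]
  exact PiLp.norm_apply_le (WithLp.toLp 2 x) i

theorem enorm3_le_two_mul {x : Fin 3 → ℝ} {i : Fin 3} (h : ∀ j, |x j| ≤ |x i|) :
    enorm3 x ≤ 2 * |x i| := by
  refine Real.sqrt_le_iff.2 ⟨by positivity, ?_⟩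
  have h' : ∀ j, x j ^ 2 ≤ x i ^ 2 := fun j => sq_le_sq.2 (h j)
  rw [Fin.sum_univ_three, mul_pow, sq_abs]
  linarith [h' 0, h' 1, h' 2, sq_nonneg (x i)]

theorem dotProduct_sq_add_enorm3_cross_sq (x y : Fin 3 → ℝ) :
    (x ⬝ᵥ y) ^ 2 + enorm3 (x ⨯₃ y) ^ 2 = (enorm3 x * enorm3 y) ^ 2 := by
  rw [mul_pow, enorm3_sq, enorm3_sq, enorm3_sq, cross_dot_cross, dotProduct_comm y x]
  ring

theorem abs_dotProduct_le (x y : Fin 3 → ℝ) : |x ⬝ᵥ y| ≤ enorm3 x * enorm3 y :=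
  abs_le_of_sq_le_sq
    (by linarith [dotProduct_sq_add_enorm3_cross_sq x y, sq_nonneg (enorm3 (x ⨯₃ y))])
    (mul_nonneg (enorm3_nonneg x) (enorm3_nonneg y))

theorem enorm3_cross_le (x y : Fin 3 → ℝ) : enorm3 (x ⨯₃ y) ≤ enorm3 x * enorm3 y :=
  le_of_sq_le_sq
    (by linarith [dotProduct_sq_add_enorm3_cross_sq x y, sq_nonneg (x ⬝ᵥ y)])
    (mul_nonneg (enorm3_nonneg x) (enorm3_nonneg y))

theorem enorm3_cross_comm (x y : Fin 3 → ℝ) : enorm3 (x ⨯₃ y) = enorm3 (y ⨯₃ x) := by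
  rw [← cross_anticomm, ← neg_one_smul ℝ, enorm3_smul]; simp

theorem enorm3_mul_enorm3_cross_le (w m h : Fin 3 → ℝ) :
    enorm3 w * enorm3 (m ⨯₃ h) ≤
      enorm3 m * enorm3 (h ⨯₃ w) + enorm3 h * enorm3 (m ⨯₃ w) := by
  rcases eq_or_ne w 0 with rfl | hw
  · have h0 : enorm3 0 = 0 := by simp [enorm3]
    simp [h0]
  have hw' := enorm3_pos hw
  have key : (w ⬝ᵥ w) • (m ⨯₃ h) = (m ⬝ᵥ w) • (w ⨯₃ h) + (w ⨯₃ (m ⨯₃ w)) ⨯₃ h := by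
    ext i
    fin_cases i <;> simp [cross_apply, dotProduct, Fin.sum_univ_three] <;> ring
  refine le_of_mul_le_mul_left ?_ hw'
  calc enorm3 w * (enorm3 w * enorm3 (m ⨯₃ h)) = enorm3 ((w ⬝ᵥ w) • (m ⨯₃ h)) := by
        rw [enorm3_smul, ← enorm3_sq, abs_of_nonneg (by positivity)]; ring
    _ ≤ |m ⬝ᵥ w| * enorm3 (w ⨯₃ h) + enorm3 ((w ⨯₃ (m ⨯₃ w)) ⨯₃ h) := by
        rw [key, ← enorm3_smul]; exact enorm3_add_le _ _
    _ ≤ (enorm3 m * enorm3 w) * enorm3 (h ⨯₃ w) + (enorm3 w * enorm3 (m ⨯₃ w)) * enorm3 h := by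
        rw [enorm3_cross_comm w h]
        gcongr
        · exact enorm3_nonneg _
        · exact abs_dotProduct_le _ _
        · refine (enorm3_cross_le _ _).trans ?_
          gcongr
          · exact enorm3_nonneg _
          · exact enorm3_cross_le _ _
    _ = _ := by ring

theorem Qform_eq (A : Matrix (Fin 3) (Fin 3) ℝ) (x : Fin 3 → ℝ) :
    Qform A x = x ⬝ᵥ A *ᵥ x := by
  simp only [Qform, dotProduct, mulVec, Finset.mul_sum]
  exact Finset.sum_congr rfl fun i _ => Finset.sum_congr rfl fun j _ => by ring

theorem dotProduct_mulVec_comm {A : Matrix (Fin 3) (Fin 3) ℝ} (hA : A.IsSymm)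
    (x y : Fin 3 → ℝ) : x ⬝ᵥ A *ᵥ y = y ⬝ᵥ A *ᵥ x := by
  rw [dotProduct_mulVec, ← mulVec_transpose, hA.eq, dotProduct_comm]

theorem exists_Qform_le (A : Matrix (Fin 3) (Fin 3) ℝ) :
    ∃ M : ℝ, 0 ≤ M ∧ ∀ x, Qform A x ≤ M * enorm3 x ^ 2 := by
  refine ⟨∑ i, ∑ j, |A i j|, by positivity, fun x => ?_⟩
  simp only [Qform, Finset.sum_mul]
  refine Finset.sum_le_sum fun i _ => Finset.sum_le_sum fun j _ => ?_
  calc A i j * x i * x j ≤ |A i j * x i * x j| := le_abs_self _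
    _ = |A i j| * (|x i| * |x j|) := by rw [abs_mul, abs_mul, mul_assoc]
    _ ≤ |A i j| * enorm3 x ^ 2 := by
      rw [sq]
      gcongr
      · exact enorm3_nonneg _
      · exact abs_apply_le_enorm3 x i
      · exact abs_apply_le_enorm3 x j

theorem exists_le_Qform {A : Matrix (Fin 3) (Fin 3) ℝ} (hA : A.PosDef) :
    ∃ μ : ℝ, 0 < μ ∧ ∀ x, μ * enorm3 x ^ 2 ≤ Qform A x := by
  have hpos : ∀ x ≠ 0, 0 < Qform A x := fun x hx => by
    simpa [Qform_eq] using hA.dotProduct_mulVec_pos hx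
  obtain ⟨z, hz, hmin⟩ := (isCompact_sphere (0 : EuclideanSpace ℝ (Fin 3)) 1).exists_isMinOn
    (NormedSpace.sphere_nonempty.2 zero_le_one)
    (f := fun z => Qform A z.ofLp) (by unfold Qform; fun_prop)
  have hz0 : z.ofLp ≠ 0 := by
    intro h
    have : z = 0 := by simpa using h
    simp [this] at hz
  refine ⟨Qform A z.ofLp, hpos _ hz0, fun x => ?_⟩
  rcases eq_or_ne x 0 with rfl | hx
  · simp [Qform, enorm3]
  have hx' := enorm3_pos hx
  have hmem : WithLp.toLp 2 ((enorm3 x)⁻¹ • x) ∈ Metric.sphere (0 : EuclideanSpace ℝ (Fin 3)) 1 := by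
    rw [mem_sphere_zero_iff_norm, ← enorm3_eq_norm, enorm3_smul, abs_of_pos (by positivity),
      inv_mul_cancel₀ hx'.ne']
  have h1 : Qform A z.ofLp ≤ Qform A ((enorm3 x)⁻¹ • x) := hmin hmem
  have h2 : Qform A ((enorm3 x)⁻¹ • x) * enorm3 x ^ 2 = Qform A x := by
    simp only [Qform_eq, mulVec_smul, dotProduct_smul, smul_dotProduct, smul_eq_mul]
    field_simp
  rw [← h2]
  gcongr

theorem dotProduct_add_sub_eq_zero {A : Matrix (Fin 3) (Fin 3) ℝ} (hA : A.IsSymm)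
    {x y : Fin 3 → ℝ} (hxy : Qform A x = Qform A y) :
    (A *ᵥ x + A *ᵥ y) ⬝ᵥ (x - y) = 0 := by
  rw [Qform_eq, Qform_eq] at hxy
  rw [dotProduct_comm, sub_dotProduct, dotProduct_add, dotProduct_add, hxy,
    dotProduct_mulVec_comm hA x y]
  ring

theorem mul_enorm3_le_enorm3_cross {A : Matrix (Fin 3) (Fin 3) ℝ} {μ : ℝ}
    (hμ : ∀ x, μ * enorm3 x ^ 2 ≤ Qform A x) {m ξ : Fin 3 → ℝ} (h : m ⬝ᵥ ξ = 0) :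
    μ * enorm3 ξ * enorm3 m ≤ enorm3 (m ⨯₃ (A *ᵥ ξ)) := by
  rcases eq_or_ne ξ 0 with rfl | hξ
  · have h0 : enorm3 0 = 0 := by simp [enorm3]
    simp [h0]
  have key : ξ ⨯₃ (m ⨯₃ (A *ᵥ ξ)) = Qform A ξ • m := by
    rw [cross_cross_eq_smul_sub_smul', Qform_eq, h, zero_smul, sub_zero]
  refine le_of_mul_le_mul_left ?_ (enorm3_pos hξ)
  calc enorm3 ξ * (μ * enorm3 ξ * enorm3 m) = μ * enorm3 ξ ^ 2 * enorm3 m := by ring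
    _ ≤ |Qform A ξ| * enorm3 m := by
      gcongr
      · exact enorm3_nonneg _
      · exact (hμ ξ).trans (le_abs_self _)
    _ = enorm3 (ξ ⨯₃ (m ⨯₃ (A *ᵥ ξ))) := by rw [key, enorm3_smul]
    _ ≤ _ := enorm3_cross_le _ _

theorem intCast3_sub (k l : Fin 3 → ℤ) : intCast3 (k - l) = intCast3 k - intCast3 l := by
  ext; simp [intCast3]

theorem intCast3_smul (c : ℤ) (k : Fin 3 → ℤ) : intCast3 (c • k) = (c : ℝ) • intCast3 k := by
  ext; simp [intCast3]

theorem intCast3_cross (k l : Fin 3 → ℤ) :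
    intCast3 (k ⨯₃ l) = intCast3 k ⨯₃ intCast3 l := by
  ext i
  fin_cases i <;> simp [intCast3, cross_apply]

theorem intCast3_ne_zero {k : Fin 3 → ℤ} (hk : k ≠ 0) : intCast3 k ≠ 0 := by
  contrapose! hk
  ext i
  simpa [intCast3] using congrFun hk i

theorem card_mul_abs_le_of_cross {P : Finset (Fin 3 → ℤ)} {w : Fin 3 → ℤ} (hP : 2 ≤ P.card)
    (hcross : ∀ p ∈ P, ∀ q ∈ P, ∀ p' ∈ P, ∀ q' ∈ P, ∃ c : ℤ, (p - q) ⨯₃ (p' - q') = c • w)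
    (hnc : ∀ p ∈ P, ∀ q ∈ P, p ≠ q → ∃ z ∈ P, (p - q) ⨯₃ (z - q) ≠ 0)
    (a b : Fin 3 → ℝ) {X Y : ℝ} (hX : 0 < X) (hY : 0 < Y)
    (ha : ∀ p ∈ P, ∀ q ∈ P, |a ⬝ᵥ intCast3 (p - q)| ≤ X)
    (hb : ∀ p ∈ P, ∀ q ∈ P, |b ⬝ᵥ intCast3 (p - q)| ≤ Y) :
    P.card * |(a ⨯₃ b) ⬝ᵥ intCast3 w| ≤ 32 * (X * Y) := by
  rcases eq_or_ne ((a ⨯₃ b) ⬝ᵥ intCast3 w) 0 with h0 | h0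
  · rw [h0, abs_zero, mul_zero]; positivity
  have hdet : ∀ p q p' q' : Fin 3 → ℤ,
      (a ⬝ᵥ intCast3 p / X - a ⬝ᵥ intCast3 q / X) * (b ⬝ᵥ intCast3 p' / Y - b ⬝ᵥ intCast3 q' / Y) -
      (b ⬝ᵥ intCast3 p / Y - b ⬝ᵥ intCast3 q / Y) * (a ⬝ᵥ intCast3 p' / X - a ⬝ᵥ intCast3 q' / X) =
      (a ⨯₃ b) ⬝ᵥ intCast3 ((p - q) ⨯₃ (p' - q')) / (X * Y) := by
    intro p q p' q'
    rw [intCast3_cross, cross_dot_cross]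
    simp only [intCast3_sub, dotProduct_sub]
    field_simp
  have hdet' : ∀ c : ℤ, (a ⨯₃ b) ⬝ᵥ intCast3 (c • w) / (X * Y) =
      c * ((a ⨯₃ b) ⬝ᵥ intCast3 w / (X * Y)) := by
    intro c
    rw [intCast3_smul, dotProduct_smul, smul_eq_mul, mul_div_assoc]
  have key := card_mul_le_of_noncollinear P (fun p => a ⬝ᵥ intCast3 p / X)
    (fun p => b ⬝ᵥ intCast3 p / Y) (d := |(a ⨯₃ b) ⬝ᵥ intCast3 w / (X * Y)|)
    (by positivity)
    (fun p hp q hq => by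
      rw [← sub_div, ← dotProduct_sub, ← intCast3_sub, abs_div, abs_of_pos hX, div_le_one hX]
      exact ha p hp q hq)
    (fun p hp q hq => by
      rw [← sub_div, ← dotProduct_sub, ← intCast3_sub, abs_div, abs_of_pos hY, div_le_one hY]
      exact hb p hp q hq)
    (fun p hp q hq p' hp' q' hq' => by
      obtain ⟨c, hc⟩ := hcross p hp q hq p' hp' q' hq'
      simp only [hdet]
      rw [hc, hdet']
      rcases eq_or_ne c 0 with rfl | hc0
      · simp
      · right
        rw [abs_mul]
        refine le_mul_of_one_le_left (abs_nonneg _) ?_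
        exact_mod_cast Int.one_le_abs hc0)
    (fun p hp q hq hpq => by
      obtain ⟨z, hz, hz0⟩ := hnc p hp q hq hpq
      refine ⟨z, hz, ?_⟩
      obtain ⟨c, hc⟩ := hcross p hp q hq z hz q hq
      simp only [hdet]
      rw [hc, hdet']
      have hc0 : c ≠ 0 := by
        rintro rfl
        rw [hc, zero_smul] at hz0
        exact hz0 rfl
      have : (c : ℝ) ≠ 0 := by exact_mod_cast hc0
      positivity)
    hP
  rwa [abs_div, abs_of_pos (mul_pos hX hY), mul_div_assoc', div_le_iff₀ (mul_pos hX hY)] at key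

theorem exists_cross_of_basis {P : Set (Fin 3 → ℤ)} {L : Submodule ℤ (Fin 3 → ℤ)}
    (hL : L = Submodule.span ℤ {d | ∃ y ∈ P, ∃ z ∈ P, d = y - z}) {u v w : Fin 3 → ℤ}
    (hu : u ∈ L) (hv : v ∈ L)
    (hspan : ∀ z ∈ L, ∃ a b : ℤ, z = a • u + b • v)
    (hw0 : w ≠ 0) (hw : u ⨯₃ v = w ∨ u ⨯₃ v = -w) :
    (∀ p ∈ P, ∀ q ∈ P, ∀ p' ∈ P, ∀ q' ∈ P, ∃ c : ℤ, (p - q) ⨯₃ (p' - q') = c • w) ∧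
    ∀ p ∈ P, ∀ q ∈ P, p ≠ q → ∃ z ∈ P, (p - q) ⨯₃ (z - q) ≠ 0 := by
  have hsub : ∀ p ∈ P, ∀ q ∈ P, p - q ∈ L := fun p hp q hq =>
    hL ▸ Submodule.subset_span ⟨p, hp, q, hq, rfl⟩
  have hvu : v ⨯₃ u = -(u ⨯₃ v) := (cross_anticomm u v).symm
  constructor
  · intro p hp q hq p' hp' q' hq'
    obtain ⟨a, b, h⟩ := hspan _ (hsub p hp q hq)
    obtain ⟨a', b', h'⟩ := hspan _ (hsub p' hp' q' hq')
    have h1 : (p - q) ⨯₃ (p' - q') = (a * b' - b * a') • (u ⨯₃ v) := by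
      rw [h, h']
      simp only [map_add, map_smul, LinearMap.add_apply, LinearMap.smul_apply, cross_self, hvu]
      module
    rcases hw with hw | hw
    · exact ⟨_, by rw [h1, hw]⟩
    · exact ⟨-(a * b' - b * a'), by rw [h1, hw]; module⟩
  · intro p hp q hq hpq
    by_contra! hcon
    have huv : u ⨯₃ v ≠ 0 := by
      rcases hw with hw | hw <;> simpa [hw] using hw0
    have hker : L ≤ LinearMap.ker (crossProduct (p - q)) := by
      rw [hL, Submodule.span_le]
      rintro d ⟨y, hy, z, hz, rfl⟩
      rw [SetLike.mem_coe, LinearMap.mem_ker, ← sub_sub_sub_cancel_right y z q, map_sub,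
        hcon y hy, hcon z hz, sub_zero]
    obtain ⟨a, b, h⟩ := hspan _ (hsub p hp q hq)
    have h1 : (p - q) ⨯₃ u = 0 := hker hu
    have h2 : (p - q) ⨯₃ v = 0 := hker hv
    rw [h] at h1 h2
    simp only [map_add, map_smul, LinearMap.add_apply, LinearMap.smul_apply, cross_self, hvu,
      smul_zero, zero_add, add_zero, smul_neg, neg_eq_zero, smul_eq_zero, huv, or_false] at h1 h2
    apply hpq
    rw [← sub_eq_zero, h, h1, h2, zero_smul, zero_smul, add_zero]

theorem exists_half_enorm3_le (w : Fin 3 → ℝ) : ∃ a b : Fin 3 → ℝ,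
    enorm3 a = 1 ∧ enorm3 b = 1 ∧ enorm3 w ≤ 2 * |(a ⨯₃ b) ⬝ᵥ w| := by
  obtain ⟨i, hi⟩ := Finite.exists_max fun i => |w i|
  refine ⟨Pi.single (i + 1) 1, Pi.single (i + 2) 1, ?_, ?_, ?_⟩
  · simp [enorm3, Pi.single_apply]
  · simp [enorm3, Pi.single_apply]
  · convert enorm3_le_two_mul hi using 3
    fin_cases i <;> simp [cross_apply, dotProduct, Fin.sum_univ_three]

theorem cap_bounds {A : Matrix (Fin 3) (Fin 3) ℝ} (hA : A.IsSymm) {M : ℝ} (hM0 : 0 ≤ M)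
    (hM : ∀ x, Qform A x ≤ M * enorm3 x ^ 2) (hQ : ∀ x, 0 ≤ Qform A x) {lam δ : ℝ}
    (hlam : 1 < lam) (hδ0 : 0 < δ) (hδ : δ < 1) {x₀ : Fin 3 → ℝ} (hx₀ : Qform A x₀ = lam ^ 2)
    {w : Fin 3 → ℤ} (hw : w ≠ 0) {u v : Fin 3 → ℤ} (hN : 2 ≤ Ncap A lam δ x₀)
    (hu : u ∈ capSpan A lam δ x₀) (hv : v ∈ capSpan A lam δ x₀)
    (hspan : ∀ z ∈ capSpan A lam δ x₀, ∃ a b : ℤ, z = a • u + b • v)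
    (huv : u ⨯₃ v = w ∨ u ⨯₃ v = -w) :
    Ncap A lam δ x₀ * enorm3 (intCast3 w) ≤ 256 * √(lam * δ) ^ 2 ∧
    Ncap A lam δ x₀ * enorm3 ((A *ᵥ x₀) ⨯₃ intCast3 w) ≤
      64 * (3 + M) * √(lam * δ) ^ 3 := by
  obtain ⟨hcross, hnc⟩ := exists_cross_of_basis rfl hu hv hspan hw huv
  have hfin : (capLattice A lam δ x₀).Finite := by
    refine Set.finite_of_ncard_pos ?_
    change 0 < Ncap A lam δ x₀
    lia
  set r := √(lam * δ) with hr
  have hr0 : 0 < r := by positivity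
  have hr2 : r ^ 2 = lam * δ := Real.sq_sqrt (by positivity)
  set P := hfin.toFinset
  have hcard : Ncap A lam δ x₀ = P.card := Set.ncard_eq_toFinset_card _ hfin
  have hmem : ∀ {p}, p ∈ P ↔ p ∈ capLattice A lam δ x₀ := hfin.mem_toFinset
  have main := card_mul_abs_le_of_cross (hcard ▸ hN)
    (fun p hp q hq p' hp' q' hq' => hcross p (hmem.1 hp) q (hmem.1 hq) p' (hmem.1 hp') q'
      (hmem.1 hq'))
    (fun p hp q hq hpq => by
      simpa only [hmem] using hnc p (hmem.1 hp) q (hmem.1 hq) hpq)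
  rw [hcard]
  have hdiff : ∀ p ∈ P, ∀ q ∈ P, enorm3 (intCast3 (p - q)) ≤ 2 * r := by
    intro p hp q hq
    rw [intCast3_sub, ← sub_sub_sub_cancel_right _ _ x₀]
    refine (enorm3_sub_le _ _).trans ?_
    linarith [(hmem.1 hp).2, (hmem.1 hq).2]
  have hdot : ∀ a, ∀ p ∈ P, ∀ q ∈ P, |a ⬝ᵥ intCast3 (p - q)| ≤ enorm3 a * (2 * r) :=
    fun a p hp q hq => (abs_dotProduct_le _ _).trans
      (mul_le_mul_of_nonneg_left (hdiff p hp q hq) (enorm3_nonneg a))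
  constructor
  · obtain ⟨a, b, ha, hb, hab⟩ := exists_half_enorm3_le (intCast3 w)
    have h := main a b (X := 2 * r) (Y := 2 * r) (by positivity) (by positivity)
      (by simpa [ha] using hdot a) (by simpa [hb] using hdot b)
    calc P.card * enorm3 (intCast3 w) ≤ P.card * (2 * |(a ⨯₃ b) ⬝ᵥ intCast3 w|) := by gcongr
      _ = 2 * (P.card * |(a ⨯₃ b) ⬝ᵥ intCast3 w|) := by ring
      _ ≤ 2 * (32 * (2 * r * (2 * r))) := by gcongr
      _ = _ := by ring
  · set n := A *ᵥ x₀ with hn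
    have hslab : ∀ p ∈ P, |n ⬝ᵥ (intCast3 p - x₀)| ≤ (3 + M) / 2 * r ^ 2 := by
      intro p hp
      obtain ⟨h1, h2⟩ := hmem.1 hp
      set k := intCast3 p
      have hexp : Qform A k = lam ^ 2 + 2 * (n ⬝ᵥ (k - x₀)) + Qform A (k - x₀) := by
        have hx : k = x₀ + (k - x₀) := by abel
        conv_lhs => rw [hx]
        rw [← hx₀]
        simp only [Qform_eq, mulVec_add, add_dotProduct, dotProduct_add]
        rw [dotProduct_mulVec_comm hA x₀ (k - x₀), hn, dotProduct_comm (A *ᵥ x₀)]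
        ring
      have h3 : Qform A (k - x₀) ≤ M * r ^ 2 := by
        refine (hM _).trans ?_
        gcongr
        exact enorm3_nonneg _
      have h4 : √(Qform A k) ^ 2 = Qform A k := Real.sq_sqrt (hQ _)
      have h5 : 0 ≤ √(Qform A k) := Real.sqrt_nonneg _
      have h6 : |Qform A k - lam ^ 2| ≤ 3 * r ^ 2 := by
        rw [← h4, sq_sub_sq, abs_mul, mul_comm, hr2]
        have h7 := abs_lt.1 h1
        calc _ ≤ δ * (3 * lam) := by
              gcongr
              rw [abs_of_nonneg (by positivity)]
              linarith
          _ = _ := by ring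
      have h8 := hQ (k - x₀)
      rw [abs_le] at h6 ⊢
      constructor <;> nlinarith [mul_nonneg hM0 (sq_nonneg r)]
    have hslab' : ∀ p ∈ P, ∀ q ∈ P, |n ⬝ᵥ intCast3 (p - q)| ≤ (3 + M) * r ^ 2 := by
      intro p hp q hq
      rw [intCast3_sub, ← sub_sub_sub_cancel_right _ _ x₀, dotProduct_sub]
      refine (abs_sub _ _).trans ?_
      linarith [hslab p hp, hslab q hq]
    rcases eq_or_ne (n ⨯₃ intCast3 w) 0 with h0 | h0
    · have : enorm3 0 = 0 := by simp [enorm3]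
      rw [h0, this, mul_zero]; positivity
    have hα := enorm3_pos h0
    have h := main (n ⨯₃ intCast3 w) n (X := enorm3 (n ⨯₃ intCast3 w) * (2 * r))
      (Y := (3 + M) * r ^ 2) (by positivity) (by positivity) (hdot _) hslab'
    have htriple : ((n ⨯₃ intCast3 w) ⨯₃ n) ⬝ᵥ intCast3 w = enorm3 (n ⨯₃ intCast3 w) ^ 2 := by
      rw [enorm3_sq, dotProduct_comm, triple_product_permutation]
    rw [htriple, abs_of_nonneg (by positivity)] at h
    refine le_of_mul_le_mul_left ?_ hα
    linarith

theorem abs_apply_le_add_of_dotProduct_eq_zero {m ξ : Fin 3 → ℝ} (h : m ⬝ᵥ ξ = 0) {i : Fin 3}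
    (hm : ∀ j, |m j| ≤ |m i|) (hm0 : m i ≠ 0) :
    |ξ i| ≤ |ξ (i.succAbove 0)| + |ξ (i.succAbove 1)| := by
  rw [dotProduct, Fin.sum_univ_succAbove _ i, Fin.sum_univ_two] at h
  refine le_of_mul_le_mul_left ?_ (abs_pos.2 hm0)
  calc |m i| * |ξ i| = |m (i.succAbove 0) * ξ (i.succAbove 0) +
        m (i.succAbove 1) * ξ (i.succAbove 1)| := by
        rw [← abs_mul, eq_neg_of_add_eq_zero_left h, abs_neg]
    _ ≤ |m (i.succAbove 0)| * |ξ (i.succAbove 0)| + |m (i.succAbove 1)| * |ξ (i.succAbove 1)| := by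
        rw [← abs_mul, ← abs_mul]; exact abs_add_le _ _
    _ ≤ |m i| * |ξ (i.succAbove 0)| + |m i| * |ξ (i.succAbove 1)| := by
        gcongr ?_ * _ + ?_ * _ <;> exact hm _
    _ = _ := by ring

theorem enorm3_le_of_dotProduct_eq_zero {m ξ : Fin 3 → ℝ} (h : m ⬝ᵥ ξ = 0) {i : Fin 3}
    (hm : ∀ j, |m j| ≤ |m i|) (hm0 : m i ≠ 0) :
    enorm3 ξ ≤ 2 * (|ξ (i.succAbove 0)| + |ξ (i.succAbove 1)|) := by
  have h1 := abs_apply_le_add_of_dotProduct_eq_zero h hm hm0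
  refine Real.sqrt_le_iff.2 ⟨by positivity, ?_⟩
  rw [Fin.sum_univ_succAbove _ i, Fin.sum_univ_two, ← sq_abs (ξ i), ← sq_abs (ξ (i.succAbove 0)),
    ← sq_abs (ξ (i.succAbove 1))]
  nlinarith [abs_nonneg (ξ i), abs_nonneg (ξ (i.succAbove 0)), abs_nonneg (ξ (i.succAbove 1)),
    mul_nonneg (abs_nonneg (ξ (i.succAbove 0))) (abs_nonneg (ξ (i.succAbove 1)))]

theorem abs_add_apply_of_dominant {n n' : Fin 3 → ℝ} {i : Fin 3} (hn : ∀ j, |n j| ≤ |n i|)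
    (hn' : ∀ j, |n' j| ≤ |n' i|) (hsign : 0 ≤ n i ↔ 0 ≤ n' i) :
    (∀ j, |(n + n') j| ≤ |(n + n') i|) ∧ |(n + n') i| = |n i| + |n' i| := by
  have h : |(n + n') i| = |n i| + |n' i| := by
    rw [Pi.add_apply, abs_add_eq_add_abs_iff]
    rcases le_or_gt 0 (n i) with h | h
    · exact Or.inl ⟨h, hsign.1 h⟩
    · exact Or.inr ⟨h.le, (not_le.1 (mt hsign.2 h.not_ge)).le⟩
  refine ⟨fun j => ?_, h⟩
  rw [h]
  exact (abs_add_le _ _).trans (add_le_add (hn j) (hn' j))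

theorem enorm3_sub_le_of_patch {A : Matrix (Fin 3) (Fin 3) ℝ} (hA : A.IsSymm) {μ : ℝ}
    (hμ : ∀ x, μ * enorm3 x ^ 2 ≤ Qform A x) {x y w : Fin 3 → ℝ} (hxy : Qform A x = Qform A y)
    {i : Fin 3} (hx : ∀ j, |(A *ᵥ x) j| ≤ |(A *ᵥ x) i|) (hy : ∀ j, |(A *ᵥ y) j| ≤ |(A *ᵥ y) i|)
    (hsign : 0 ≤ (A *ᵥ x) i ↔ 0 ≤ (A *ᵥ y) i) (hx0 : (A *ᵥ x) i ≠ 0) {K : ℝ}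
    (hxK : enorm3 ((A *ᵥ x) ⨯₃ w) ≤ K) (hyK : enorm3 ((A *ᵥ y) ⨯₃ w) ≤ K) :
    enorm3 w * (μ * enorm3 (x - y)) ≤ 6 * K := by
  obtain ⟨-, hmi⟩ := abs_add_apply_of_dominant hx hy hsign
  have horth := dotProduct_add_sub_eq_zero hA hxy
  set m := A *ᵥ x + A *ᵥ y with hm
  have hh : enorm3 (A *ᵥ (x - y)) ≤ 2 * enorm3 m := by
    rw [mulVec_sub]
    refine (enorm3_sub_le _ _).trans ?_
    linarith [enorm3_le_two_mul hx, enorm3_le_two_mul hy, abs_apply_le_enorm3 m i]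
  have hm0 : 0 < enorm3 m :=
    lt_of_lt_of_le (by rw [hmi]; positivity) (abs_apply_le_enorm3 m i)
  have hmK : enorm3 (m ⨯₃ w) ≤ 2 * K := by
    rw [hm, map_add, LinearMap.add_apply]
    exact (enorm3_add_le _ _).trans (by linarith)
  have hhK : enorm3 ((A *ᵥ (x - y)) ⨯₃ w) ≤ 2 * K := by
    rw [mulVec_sub, map_sub, LinearMap.sub_apply]
    exact (enorm3_sub_le _ _).trans (by linarith)
  have hK : 0 ≤ K := (enorm3_nonneg _).trans hxK
  refine le_of_mul_le_mul_right ?_ hm0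
  calc enorm3 w * (μ * enorm3 (x - y)) * enorm3 m
      = enorm3 w * (μ * enorm3 (x - y) * enorm3 m) := by ring
    _ ≤ enorm3 w * enorm3 (m ⨯₃ (A *ᵥ (x - y))) :=
      mul_le_mul_of_nonneg_left (mul_enorm3_le_enorm3_cross hμ horth) (enorm3_nonneg w)
    _ ≤ enorm3 m * enorm3 ((A *ᵥ (x - y)) ⨯₃ w) + enorm3 (A *ᵥ (x - y)) * enorm3 (m ⨯₃ w) :=
      enorm3_mul_enorm3_cross_le _ _ _
    _ ≤ enorm3 m * (2 * K) + (2 * enorm3 m) * (2 * K) := by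
      gcongr
      exact enorm3_nonneg _
    _ = 6 * K * enorm3 m := by ring

theorem card_le_of_patches {A : Matrix (Fin 3) (Fin 3) ℝ} (hA : A.IsSymm) {μ : ℝ} (hμ0 : 0 < μ)
    (hμ : ∀ x, μ * enorm3 x ^ 2 ≤ Qform A x) {w : Fin 3 → ℝ} (hw : w ≠ 0) {lam r K : ℝ}
    (hlam : lam ≠ 0) (hr : 0 < r) (hK0 : 0 ≤ K) (S : Finset (Fin 3 → ℝ))
    (hS : ∀ x ∈ S, Qform A x = lam ^ 2)
    (hsep : ∀ x ∈ S, ∀ y ∈ S, x ≠ y → r ≤ enorm3 (x - y))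
    (hK : ∀ x ∈ S, enorm3 ((A *ᵥ x) ⨯₃ w) ≤ K) :
    (S.card : ℝ) ≤ 6 * (2 * (6 * K / (enorm3 w * μ)) / (r / 4) + 2) ^ 2 := by
  classical
  choose i hi using fun x : Fin 3 → ℝ => Finite.exists_max fun i => |(A *ᵥ x) i|
  have hi0 : ∀ x ∈ S, (A *ᵥ x) (i x) ≠ 0 := by
    intro x hx h0
    have h1 : A *ᵥ x = 0 := by
      ext j
      have := hi x j
      rw [h0, abs_zero] at this
      exact abs_nonpos_iff.1 this
    have h2 := hS x hx
    rw [Qform_eq, h1, dotProduct_zero] at h2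
    exact hlam (pow_eq_zero_iff two_ne_zero |>.1 h2.symm)
  have hw' := enorm3_pos hw
  let patch : (Fin 3 → ℝ) → Fin 3 × Bool := fun x => (i x, decide (0 ≤ (A *ᵥ x) (i x)))
  have hpatch : ∀ t : Fin 3 × Bool, ((S.filter fun x => patch x = t).card : ℝ) ≤
      (2 * (6 * K / (enorm3 w * μ)) / (r / 4) + 2) ^ 2 := by
    rintro ⟨k, σ⟩
    have hP : ∀ x ∈ S.filter (fun x => patch x = (k, σ)),
        x ∈ S ∧ (∀ j, |(A *ᵥ x) j| ≤ |(A *ᵥ x) k|) ∧ decide (0 ≤ (A *ᵥ x) k) = σ ∧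
        (A *ᵥ x) k ≠ 0 := by
      intro x hx
      obtain ⟨hxS, hxp⟩ := Finset.mem_filter.1 hx
      obtain ⟨rfl, h2⟩ := Prod.mk.inj hxp
      exact ⟨hxS, hi x, h2, hi0 x hxS⟩
    have hR : 0 ≤ 6 * K / (enorm3 w * μ) := by positivity
    have hdist : ∀ x ∈ S.filter (fun x => patch x = (k, σ)),
        ∀ y ∈ S.filter (fun x => patch x = (k, σ)), ∀ j,
        |x j - y j| ≤ 6 * K / (enorm3 w * μ) := by
      intro x hx y hy j
      obtain ⟨hxS, hx1, hx2, hx3⟩ := hP x hx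
      obtain ⟨hyS, hy1, hy2, -⟩ := hP y hy
      refine (abs_apply_le_enorm3 (x - y) j).trans ?_
      rw [le_div_iff₀ (by positivity)]
      linarith [enorm3_sub_le_of_patch hA hμ ((hS x hxS).trans (hS y hyS).symm) hx1 hy1
        (decide_eq_decide.1 (hx2.trans hy2.symm)) hx3 (hK x hxS) (hK y hyS)]
    rw [sq]
    refine card_le_of_separated _ (fun x => x (k.succAbove 0)) (fun x => x (k.succAbove 1))
      (by positivity) (by positivity) hR hR (fun x hx y hy => hdist x hx y hy _)
      (fun x hx y hy => hdist x hx y hy _) ?_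
    intro x hx y hy hxy
    obtain ⟨hxS, hx1, hx2, hx3⟩ := hP x hx
    obtain ⟨hyS, hy1, hy2, -⟩ := hP y hy
    obtain ⟨hm, hmk⟩ := abs_add_apply_of_dominant hx1 hy1 (decide_eq_decide.1 (hx2.trans hy2.symm))
    have hm0 : (A *ᵥ x + A *ᵥ y) k ≠ 0 := by
      rw [← abs_pos, hmk]; positivity
    have h1 := enorm3_le_of_dotProduct_eq_zero
      (dotProduct_add_sub_eq_zero hA ((hS x hxS).trans (hS y hyS).symm)) hm hm0
    have h2 := hsep x hxS y hyS hxy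
    simp only [Pi.sub_apply] at h1
    by_contra! hcon
    linarith [hcon.1, hcon.2]
  rw [Finset.card_eq_sum_card_fiberwise (f := patch) (t := Finset.univ) (fun _ _ => by simp)]
  push_cast
  refine (Finset.sum_le_card_nsmul _ _ _ fun t _ => hpatch t).trans_eq ?_
  simp

theorem statement13 (A : Matrix (Fin 3) (Fin 3) ℝ) (hA : A.IsSymm) (hApd : A.PosDef) :
    ∃ C : ℝ, 0 < C ∧
      ∀ lam δ : ℝ, 1 < lam → lam⁻¹ ≤ δ → δ < 1 →
        ∀ centers : Set (Fin 3 → ℝ),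
          (∀ x ∈ centers, Qform A x = lam ^ 2) →
          (∀ x ∈ centers, ∀ y ∈ centers, x ≠ y → Real.sqrt (lam * δ) ≤ enorm3 (x - y)) →
          ∀ w₀ : Fin 3 → ℤ, w₀ ≠ 0 →
            ∀ s : ℕ, 1 ≤ s →
              (({x₀ ∈ centers |
                  Module.finrank ℤ ↥(capSpan A lam δ x₀) = 2 ∧
                  2 ^ s ≤ Ncap A lam δ x₀ ∧ Ncap A lam δ x₀ < 2 ^ (s + 1) ∧
                  ∃ u v : Fin 3 → ℤ,
                    u ∈ capSpan A lam δ x₀ ∧ v ∈ capSpan A lam δ x₀ ∧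
                    (∀ z ∈ capSpan A lam δ x₀, ∃ a b : ℤ, z = a • u + b • v) ∧
                    (∀ a b : ℤ, a • u + b • v = 0 → a = 0 ∧ b = 0) ∧
                    (crossProduct u v = w₀ ∨ crossProduct u v = -w₀)}).ncard : ℝ)
                ≤ C * (lam * δ * (2:ℝ) ^ (-(s:ℝ)) / enorm3 (intCast3 w₀)) ^ 2 := by
  obtain ⟨M, hM0, hM⟩ := exists_Qform_le A
  obtain ⟨μ, hμ0, hμ⟩ := exists_le_Qform hApd
  have hQ : ∀ x, 0 ≤ Qform A x := fun x => le_trans (by positivity) (hμ x)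
  refine ⟨6 * (8 * (384 * (3 + M) / μ) + 512) ^ 2, by positivity, ?_⟩
  intro lam δ hlam hlamδ hδ centers hcenters hsep w hw s hs
  set S := {x₀ ∈ centers | _}
  have hδ0 : 0 < δ := lt_of_lt_of_le (by positivity) hlamδ
  set r := √(lam * δ) with hr
  have hr0 : 0 < r := by positivity
  have hr2 : r ^ 2 = lam * δ := Real.sq_sqrt (by positivity)
  have hw' := enorm3_pos (intCast3_ne_zero hw)
  have hpow : (2 : ℝ) ^ (-(s : ℝ)) = ((2 : ℝ) ^ s)⁻¹ := by
    rw [Real.rpow_neg zero_le_two, Real.rpow_natCast]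
  have hbounds : ∀ x ∈ S, (2 : ℝ) ^ s * enorm3 (intCast3 w) ≤ 256 * r ^ 2 ∧
      (2 : ℝ) ^ s * enorm3 ((A *ᵥ x) ⨯₃ intCast3 w) ≤ 64 * (3 + M) * r ^ 3 := by
    rintro x ⟨hx, -, hN, -, u, v, hu, hv, hspan, -, huv⟩
    have hN2 : 2 ≤ Ncap A lam δ x := (le_self_pow₀ one_le_two (by lia)).trans hN
    have hN' : (2 : ℝ) ^ s ≤ Ncap A lam δ x := by exact_mod_cast hN
    obtain ⟨h1, h2⟩ := cap_bounds hA hM0 hM hQ hlam hδ0 hδ (hcenters x hx) hw hN2 hu hv hspan huv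
    exact ⟨(mul_le_mul_of_nonneg_right hN' (enorm3_nonneg _)).trans h1,
      (mul_le_mul_of_nonneg_right hN' (enorm3_nonneg _)).trans h2⟩
  rw [hpow, ← hr2]
  rcases S.finite_or_infinite with hfin | hinf
  swap
  · rw [hinf.ncard, Nat.cast_zero]; positivity
  rcases S.eq_empty_or_nonempty with hemp | ⟨x, hx⟩
  · rw [hemp, Set.ncard_empty, Nat.cast_zero]; positivity
  have hcard := card_le_of_patches hA hμ0 hμ (intCast3_ne_zero hw) (lam := lam) (r := r)
    (K := 64 * (3 + M) * r ^ 3 / 2 ^ s) (by positivity) hr0 (by positivity) hfin.toFinset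
    (fun x hx => hcenters x (hfin.mem_toFinset.1 hx).1)
    (fun x hx y hy => hsep x (hfin.mem_toFinset.1 hx).1 y (hfin.mem_toFinset.1 hy).1)
    (fun x hx => by
      rw [le_div_iff₀' (by positivity)]
      exact (hbounds x (hfin.mem_toFinset.1 hx)).2)
  rw [Set.ncard_eq_toFinset_card _ hfin]
  refine hcard.trans ?_
  have hρ : 1 ≤ 256 * (r ^ 2 * ((2 : ℝ) ^ s)⁻¹ / enorm3 (intCast3 w)) := by
    rw [← div_eq_mul_inv, div_div, ← mul_div_assoc, one_le_div (by positivity)]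
    exact (hbounds x hx).1
  rw [mul_assoc 6, ← mul_pow]
  gcongr
  rw [add_mul]
  refine add_le_add (le_of_eq ?_) (by linarith)
  field_simp
  ring
end
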